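/- arXiv:1610.09703 — 8 statements merged into one kernel-verified Lean document; each statement's English description precedes it below -/
import Mathlib

section
/- Consider the linear control system ẋ = Ax + Bu on ℝⁿ and an n-dimensional convex compact set X with 0 ∈ X° (the interior of X). If the pair (A,B) is controllable (i.e., rank [B AB ⋯ A^{n−1}B] = n), then there exist M > 0 and λ > 1 such that for all x, y ∈ X° there exist T ≥ 0 and an admissible control u defined on [0,T] with ‖u(t)‖ ≤ M and φ(x,t,u) ∈ (λX)° for all t ∈ [0,T], and φ(x,T,u) = y, where λX := {λz : z ∈ X}. -/
open Matrix Set Pointwise MeasureTheory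

/-- Carathéodory (integral) solution of `ẋ = A x + B u + a` on `[0, T]`. -/
def IsSol {n m : ℕ} (A : Matrix (Fin n) (Fin n) ℝ) (B : Matrix (Fin n) (Fin m) ℝ)
    (a : Fin n → ℝ) (u : ℝ → Fin m → ℝ) (φ : ℝ → Fin n → ℝ) (T : ℝ) : Prop :=
  ∀ t ∈ Set.Icc (0 : ℝ) T,
    φ t = φ 0 + ∫ s in (0 : ℝ)..t, (A.mulVec (φ s) + B.mulVec (u s) + a)

/-- Controllability matrix `[B AB ⋯ A^{n-1}B]`. -/
def ctrbMat {n m : ℕ} (A : Matrix (Fin n) (Fin n) ℝ) (B : Matrix (Fin n) (Fin m) ℝ) :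
    Matrix (Fin n) (Fin n × Fin m) ℝ :=
  Matrix.of fun i p => ((A ^ (p.1 : ℕ)) * B) i p.2

/-- Kalman controllability of the pair `(A, B)`: the controllability matrix has rank `n`. -/
def Controllable {n m : ℕ} (A : Matrix (Fin n) (Fin n) ℝ)
    (B : Matrix (Fin n) (Fin m) ℝ) : Prop :=
  (ctrbMat A B).rank = n

/-- An `n`-dimensional polytope: convex hull of finitely many points, with nonempty interior. -/
def IsNPolytope {n : ℕ} (X : Set (Fin n → ℝ)) : Prop :=
  (∃ V : Finset (Fin n → ℝ), X = convexHull ℝ (V : Set (Fin n → ℝ))) ∧ (interior X).Nonempty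

/-- The set `𝒪` of possible equilibria of `ẋ = A x + B u + a`:
points `x` with `A x + a ∈ Im B`. -/
def equilSet {n m : ℕ} (A : Matrix (Fin n) (Fin n) ℝ) (B : Matrix (Fin n) (Fin m) ℝ)
    (a : Fin n → ℝ) : Set (Fin n → ℝ) :=
  {x | ∃ u : Fin m → ℝ, A.mulVec x + a = B.mulVec u}

/-- The Bouligand tangent cone to a set `S` at `x`. -/
def bouligand {n : ℕ} (S : Set (Fin n → ℝ)) (x : Fin n → ℝ) : Set (Fin n → ℝ) :=
  {v | Filter.liminf (fun t : ℝ => Metric.infDist (x + t • v) S / t)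
        (nhdsWithin 0 (Set.Ioi 0)) = 0}

/-- Relaxed in-block controllability of `ẋ = Ax + Bu + a` w.r.t. `X` through `X'`:
all states of `X°` are mutually accessible through `X'°` with uniformly bounded controls. -/
def RIBC {n m : ℕ} (A : Matrix (Fin n) (Fin n) ℝ) (B : Matrix (Fin n) (Fin m) ℝ)
    (a : Fin n → ℝ) (X X' : Set (Fin n → ℝ)) : Prop :=
  ∃ M > (0 : ℝ), ∀ x ∈ interior X, ∀ y ∈ interior X,
    ∃ T ≥ (0 : ℝ), ∃ u : ℝ → Fin m → ℝ, ∃ φ : ℝ → Fin n → ℝ,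
      Measurable u ∧ IsSol A B a u φ T ∧ φ 0 = x ∧ φ T = y ∧
      (∀ t ∈ Set.Icc (0 : ℝ) T, ‖u t‖ ≤ M) ∧
      (∀ t ∈ Set.Icc (0 : ℝ) T, φ t ∈ interior X')


open Polynomial in
noncomputable def chainF (a : ℕ → ℝ) : ℕ → (ℝ[X] →ₗ[ℝ] ℝ[X])
  | 0 => LinearMap.id
  | j+1 => derivative ∘ₗ chainF a j + a j • LinearMap.id

open Polynomial in
lemma chainF_succ (a : ℕ → ℝ) (j : ℕ) (w : ℝ[X]) :
    chainF a (j+1) w = derivative (chainF a j w) + a j • w := rfl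

open Polynomial in
lemma chainF_deriv (a : ℕ → ℝ) (n : ℕ) (w : ℝ[X]) (c : ℝ)
    (h : ∀ j < n, (chainF a j w).eval c = 0) :
    ∀ i j, i + j < n → (derivative^[i] (chainF a j w)).eval c = 0 := by
  intro i
  induction i with
  | zero => intro j hj; simpa using h j (by omega)
  | succ i ih =>
    intro j hj
    have h1 := ih (j+1) (by omega)
    have h2 := ih 0 (by omega)
    rw [chainF_succ, iterate_map_add, iterate_derivative_smul] at h1
    have h3 : chainF a 0 w = w := rfl
    rw [h3] at h2
    rw [Function.iterate_succ_apply]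
    simpa [h2] using h1

open Polynomial in
lemma chainF_dvd (a : ℕ → ℝ) (n : ℕ) (w : ℝ[X]) (c : ℝ)
    (h : ∀ j < n, (chainF a j w).eval c = 0) : (X - C c) ^ n ∣ w := by
  rcases eq_or_ne w 0 with rfl | hw
  · simp
  rcases n with _ | n
  · simp
  rw [← le_rootMultiplicity_iff hw]
  have := (lt_rootMultiplicity_iff_isRoot_iterate_derivative (p := w) (t := c) (n := n) hw).2
  exact this fun k hk => chainF_deriv a (n+1) w c h k 0 (by omega)

open Polynomial in
lemma chainF_interp (a : ℕ → ℝ) (n : ℕ) (e0 e1 : Fin n → ℝ) :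
    ∃ w : ℝ[X], ∀ j : Fin n, (chainF a j w).eval 0 = e0 j ∧ (chainF a j w).eval 1 = e1 j := by
  let ev : ℝ → (ℝ[X] →ₗ[ℝ] (Fin n → ℝ)) := fun c =>
    LinearMap.pi fun j => (leval c) ∘ₗ chainF a j
  let G : degreeLT ℝ (n+n) →ₗ[ℝ] (Fin n → ℝ) × (Fin n → ℝ) :=
    ((ev 0).prod (ev 1)) ∘ₗ (degreeLT ℝ (n+n)).subtype
  have : FiniteDimensional ℝ (degreeLT ℝ (n+n)) :=
    (degreeLTEquiv ℝ (n+n)).symm.finiteDimensional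
  have hfr : Module.finrank ℝ (degreeLT ℝ (n+n)) = Module.finrank ℝ ((Fin n → ℝ) × (Fin n → ℝ)) := by
    rw [(degreeLTEquiv ℝ (n+n)).finrank_eq]; simp
  have hinj : Function.Injective G := by
    rw [← LinearMap.ker_eq_bot, LinearMap.ker_eq_bot']
    rintro ⟨w, hw⟩ hG
    have hG0 : ev 0 w = 0 := congrArg Prod.fst hG
    have hG1 : ev 1 w = 0 := congrArg Prod.snd hG
    have d0 := chainF_dvd a n w 0 fun j hj => congrFun hG0 ⟨j, hj⟩
    have d1 := chainF_dvd a n w 1 fun j hj => congrFun hG1 ⟨j, hj⟩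
    have hc : IsCoprime ((X - C (0:ℝ)) ^ n) ((X - C (1:ℝ)) ^ n) :=
      (isCoprime_X_sub_C_of_isUnit_sub (by simp)).pow
    have hd := hc.mul_dvd d0 d1
    have : w = 0 := by
      by_contra hne
      have h1 := natDegree_le_of_dvd hd hne
      rw [mem_degreeLT] at hw
      have h2 := (natDegree_lt_iff_degree_lt hne).2 hw
      rw [((monic_X_sub_C (0:ℝ)).pow n).natDegree_mul ((monic_X_sub_C (1:ℝ)).pow n)] at h1
      simp only [natDegree_pow, natDegree_X_sub_C] at h1
      omega
    exact Subtype.ext this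
  have hsurj := (LinearMap.injective_iff_surjective_of_finrank_eq_finrank hfr).1 hinj
  obtain ⟨w, hw⟩ := hsurj (e0, e1)
  exact ⟨w.1, fun j => ⟨congrFun (congrArg Prod.fst hw) j, congrFun (congrArg Prod.snd hw) j⟩⟩

/-- Horner-type sum `∑_{j<N} c j • A^(N-1-j) b`. -/
def hornerSum {n : ℕ} (A : Matrix (Fin n) (Fin n) ℝ) (b : Fin n → ℝ) (c : ℕ → ℝ) (N : ℕ) :
    Fin n → ℝ := ∑ j ∈ Finset.range N, c j • ((A ^ (N - 1 - j)) *ᵥ b)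

lemma hornerSum_succ {n : ℕ} (A : Matrix (Fin n) (Fin n) ℝ) (b : Fin n → ℝ) (c : ℕ → ℝ) (N : ℕ) :
    hornerSum A b c (N+1) = A *ᵥ hornerSum A b c N + c N • b := by
  unfold hornerSum
  rw [Finset.sum_range_succ, Matrix.mulVec_sum]
  congr 1
  · refine Finset.sum_congr rfl fun j hj => ?_
    rw [Finset.mem_range] at hj
    rw [Matrix.mulVec_smul, Matrix.mulVec_mulVec, ← pow_succ']
    congr 4
    omega
  · simp

open Polynomial in
lemma chain_identity {n : ℕ} (A : Matrix (Fin n) (Fin n) ℝ) (b : Fin n → ℝ) (a : ℕ → ℝ)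
    (w : ℝ[X]) (t : ℝ) (N : ℕ) :
    hornerSum A b (fun j => (derivative (chainF a j w)).eval t) N
      = A *ᵥ hornerSum A b (fun j => (chainF a j w).eval t) N + (chainF a N w).eval t • b
        - (w.eval t) • ((A ^ N) *ᵥ b + hornerSum A b a N) := by
  induction N with
  | zero => simp [hornerSum, chainF]
  | succ N ih =>
    rw [hornerSum_succ, hornerSum_succ, hornerSum_succ, ih, chainF_succ, pow_succ',
      ← Matrix.mulVec_mulVec]
    simp only [Matrix.mulVec_add, Matrix.mulVec_sub, Matrix.mulVec_smul, eval_add, eval_smul,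
      smul_eq_mul]
    module

lemma charpoly_horner {n : ℕ} (A : Matrix (Fin n) (Fin n) ℝ) (b : Fin n → ℝ) :
    (A ^ n) *ᵥ b + hornerSum A b (fun j => A.charpoly.coeff (n - 1 - j)) n = 0 := by
  have h := Matrix.aeval_self_charpoly A
  have hd : A.charpoly.natDegree = n := by simp [Matrix.charpoly_natDegree_eq_dim]
  have hm : A.charpoly.coeff n = 1 := by
    have := (Matrix.charpoly_monic A).coeff_natDegree
    rwa [hd] at this
  rw [Polynomial.aeval_eq_sum_range, hd, Finset.sum_range_succ, hm, one_smul,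
    ← Finset.sum_range_reflect] at h
  have h2 := congrArg (fun M => M *ᵥ b) h
  simp only [Matrix.add_mulVec, Matrix.sum_mulVec, Matrix.smul_mulVec, Matrix.zero_mulVec] at h2
  rw [add_comm]
  exact h2

lemma steer {n m : ℕ} (A : Matrix (Fin n) (Fin n) ℝ) (B : Matrix (Fin n) (Fin m) ℝ)
    (hctrb : Controllable A B) (x y : Fin n → ℝ) :
    ∃ (φ : ℝ → Fin n → ℝ) (u : ℝ → Fin m → ℝ),
      (∀ t, HasDerivAt φ (A *ᵥ φ t + B *ᵥ u t) t) ∧ Continuous u ∧ φ 0 = x ∧ φ 1 = y := by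
  have hsurj : ∀ x : Fin n → ℝ, ∃ z, ctrbMat A B *ᵥ z = x := by
    have : Function.Surjective (ctrbMat A B).mulVecLin := by
      rw [← LinearMap.range_eq_top]
      apply Submodule.eq_top_of_finrank_eq
      have h : (ctrbMat A B).rank = n := hctrb
      rw [Matrix.rank] at h
      rw [h]; simp
    exact this
  have hz : ∀ (z : Fin n × Fin m → ℝ) (c : Fin m → ℕ → ℝ),
      (∀ i, ∀ j : Fin n, c i j = z (j.rev, i)) →
      ∑ i, hornerSum A (B.col i) (c i) n = ctrbMat A B *ᵥ z := by
    intro z c hc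
    have h1 : ctrbMat A B *ᵥ z = ∑ i, ∑ k : Fin n, z (k, i) • ((A ^ (k:ℕ)) *ᵥ B.col i) := by
      ext r
      simp only [Matrix.mulVec, dotProduct, ctrbMat, Matrix.of_apply, Finset.sum_apply,
        Fintype.sum_prod_type, Pi.smul_apply, smul_eq_mul, Matrix.mul_apply, Matrix.col_apply]
      rw [Finset.sum_comm]
      refine Finset.sum_congr rfl fun i _ => Finset.sum_congr rfl fun k _ => mul_comm _ _
    rw [h1]
    refine Finset.sum_congr rfl fun i _ => ?_
    rw [hornerSum, ← Fin.sum_univ_eq_sum_range (fun j => c i j • ((A ^ (n - 1 - j)) *ᵥ B.col i))]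
    rw [← Equiv.sum_comp Fin.revPerm (fun k : Fin n => z (k, i) • ((A ^ (k:ℕ)) *ᵥ B.col i))]
    refine Finset.sum_congr rfl fun j _ => ?_
    rw [hc]
    simp only [Fin.revPerm_apply, Fin.val_rev]
    congr 3
    omega
  obtain ⟨z0, hz0⟩ := hsurj x
  obtain ⟨z1, hz1⟩ := hsurj y
  let a : ℕ → ℝ := fun j => A.charpoly.coeff (n - 1 - j)
  choose w hw using fun i : Fin m =>
    chainF_interp a n (fun j => z0 (j.rev, i)) (fun j => z1 (j.rev, i))
  refine ⟨fun t => ∑ i, hornerSum A (B.col i) (fun j => (chainF a j (w i)).eval t) n,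
    fun t i => (chainF a n (w i)).eval t, ?_, ?_, ?_, ?_⟩
  · intro t
    have h1 : A *ᵥ (∑ i, hornerSum A (B.col i) (fun j => (chainF a j (w i)).eval t) n)
        + B *ᵥ (fun i => (chainF a n (w i)).eval t)
        = ∑ i, hornerSum A (B.col i) (fun j => (Polynomial.derivative (chainF a j (w i))).eval t) n := by
      have h2 : B *ᵥ (fun i => (chainF a n (w i)).eval t)
          = ∑ i, (chainF a n (w i)).eval t • B.col i := by
        ext r
        simp [Matrix.mulVec, dotProduct, Finset.sum_apply, mul_comm]
      rw [h2, Matrix.mulVec_sum, ← Finset.sum_add_distrib]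
      refine Finset.sum_congr rfl fun i _ => ?_
      rw [chain_identity, charpoly_horner, smul_zero, sub_zero]
    rw [h1]
    refine HasDerivAt.fun_sum fun i _ => ?_
    unfold hornerSum
    refine HasDerivAt.fun_sum fun j _ => ?_
    exact (Polynomial.hasDerivAt _ t).smul_const _
  · exact continuous_pi fun i => Polynomial.continuous _
  · exact (hz z0 _ fun i j => (hw i j).1).trans hz0
  · exact (hz z1 _ fun i j => (hw i j).2).trans hz1

/-- The space of (smooth) solutions. -/
def solSpace {n m : ℕ} (A : Matrix (Fin n) (Fin n) ℝ) (B : Matrix (Fin n) (Fin m) ℝ) :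
    Submodule ℝ ((ℝ → Fin n → ℝ) × (ℝ → Fin m → ℝ)) where
  carrier := {p | (∀ t, HasDerivAt p.1 (A *ᵥ p.1 t + B *ᵥ p.2 t) t) ∧ Continuous p.2}
  add_mem' := by
    rintro p q ⟨hp, hp'⟩ ⟨hq, hq'⟩
    refine ⟨fun t => ?_, hp'.add hq'⟩
    refine ((hp t).add (hq t)).congr_deriv ?_
    change _ = A *ᵥ (p.1 t + q.1 t) + B *ᵥ (p.2 t + q.2 t)
    rw [Matrix.mulVec_add, Matrix.mulVec_add]
    abel
  zero_mem' := by
    refine ⟨fun t => ?_, continuous_const⟩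
    simp [hasDerivAt_zero]
  smul_mem' := by
    rintro c p ⟨hp, hp'⟩
    refine ⟨fun t => ?_, hp'.const_smul c⟩
    refine ((hp t).const_smul c).congr_deriv ?_
    change _ = A *ᵥ (c • p.1 t) + B *ᵥ (c • p.2 t)
    rw [Matrix.mulVec_smul, Matrix.mulVec_smul, smul_add]

lemma linear_family_continuous {V E : Type*} [NormedAddCommGroup V] [NormedSpace ℝ V]
    [FiniteDimensional ℝ V] [NormedAddCommGroup E] [NormedSpace ℝ E]
    (G : V →ₗ[ℝ] (ℝ → E)) (hG : ∀ v, Continuous (G v)) :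
    Continuous fun p : V × ℝ => G p.1 p.2 := by
  let b := Module.finBasis ℝ V
  have h : (fun p : V × ℝ => G p.1 p.2) = fun p => ∑ i, b.repr p.1 i • G (b i) p.2 := by
    ext p
    have h1 := congrArg (fun v => G v p.2) (b.sum_repr p.1)
    simp only [map_sum, map_smul, Finset.sum_apply, Pi.smul_apply] at h1
    exact h1.symm
  rw [h]
  refine continuous_finsetSum _ fun i _ => ?_
  refine Continuous.smul ?_ ((hG _).comp continuous_snd)
  exact (LinearMap.continuous_of_finiteDimensional (b.coord i)).comp continuous_fst

/-- If `(A,B)` is controllable, then there exist `M > 0` and `λ > 1` such that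
all states in `X°` are mutually accessible through `(λX)°` with controls bounded by `M`. -/
theorem stmt0 {n m : ℕ} (A : Matrix (Fin n) (Fin n) ℝ) (B : Matrix (Fin n) (Fin m) ℝ)
    (hB : B.rank = m) (X : Set (Fin n → ℝ))
    (hXconv : Convex ℝ X) (hXcomp : IsCompact X) (hXint : (interior X).Nonempty)
    (h0 : (0 : Fin n → ℝ) ∈ interior X)
    (hctrb : Controllable A B) :
    ∃ M > (0 : ℝ), ∃ lam : ℝ, 1 < lam ∧
      ∀ x ∈ interior X, ∀ y ∈ interior X,
        ∃ T ≥ (0 : ℝ), ∃ u : ℝ → Fin m → ℝ, ∃ φ : ℝ → Fin n → ℝ,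
          Measurable u ∧ IsSol A B 0 u φ T ∧ φ 0 = x ∧ φ T = y ∧
          (∀ t ∈ Set.Icc (0 : ℝ) T, ‖u t‖ ≤ M) ∧
          (∀ t ∈ Set.Icc (0 : ℝ) T, φ t ∈ interior (lam • X)) := by
  let ev : solSpace A B →ₗ[ℝ] (Fin n → ℝ) × (Fin n → ℝ) :=
    ((LinearMap.proj 0).prod (LinearMap.proj 1)) ∘ₗ (LinearMap.fst ℝ _ _) ∘ₗ (solSpace A B).subtype
  have hev : Function.Surjective ev := by
    rintro ⟨x, y⟩
    obtain ⟨φ, u, h1, h2, h3, h4⟩ := steer A B hctrb x y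
    exact ⟨⟨(φ, u), h1, h2⟩, Prod.ext h3 h4⟩
  obtain ⟨g, hg⟩ := ev.exists_rightInverse_of_surjective (LinearMap.range_eq_top.2 hev)
  let Gφ := (LinearMap.fst ℝ _ _) ∘ₗ (solSpace A B).subtype ∘ₗ g
  let Gu := (LinearMap.snd ℝ _ _) ∘ₗ (solSpace A B).subtype ∘ₗ g
  have hd : ∀ v t, HasDerivAt (Gφ v) (A *ᵥ Gφ v t + B *ᵥ Gu v t) t := fun v => (g v).2.1
  have hcu : ∀ v, Continuous (Gu v) := fun v => (g v).2.2
  have hcφ : ∀ v, Continuous (Gφ v) := fun v =>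
    continuous_iff_continuousAt.2 fun t => (hd v t).continuousAt
  have he0 : ∀ v, Gφ v 0 = v.1 := fun v => congrArg Prod.fst (LinearMap.congr_fun hg v)
  have he1 : ∀ v, Gφ v 1 = v.2 := fun v => congrArg Prod.snd (LinearMap.congr_fun hg v)
  clear_value Gφ Gu
  have hK : IsCompact ((X ×ˢ X) ×ˢ Icc (0:ℝ) 1) := (hXcomp.prod hXcomp).prod isCompact_Icc
  obtain ⟨Cφ, hCφ⟩ := hK.exists_bound_of_continuousOn (linear_family_continuous Gφ hcφ).continuousOn
  obtain ⟨Cu, hCu⟩ := hK.exists_bound_of_continuousOn (linear_family_continuous Gu hcu).continuousOn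
  obtain ⟨r, hr, hrX⟩ := Metric.isOpen_iff.1 isOpen_interior 0 h0
  have hlam : 1 < |Cφ| / r + 2 := by
    have : 0 ≤ |Cφ| / r := by positivity
    linarith
  refine ⟨|Cu| + 1, by positivity, |Cφ| / r + 2, hlam, fun x hx y hy => ?_⟩
  have e0 := he0 (x, y)
  have e1 := he1 (x, y)
  have hmem : ∀ t ∈ Icc (0:ℝ) 1, ((x, y), t) ∈ (X ×ˢ X) ×ˢ Icc (0:ℝ) 1 := fun t ht =>
    ⟨⟨interior_subset hx, interior_subset hy⟩, ht⟩
  refine ⟨1, zero_le_one, Gu (x, y), Gφ (x, y), (hcu _).measurable, ?_, e0, e1, ?_, ?_⟩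
  · intro t _
    have hcont : Continuous fun s => A *ᵥ Gφ (x, y) s + B *ᵥ Gu (x, y) s :=
      (continuous_const.matrix_mulVec (hcφ _)).add (continuous_const.matrix_mulVec (hcu _))
    simp only [add_zero]
    rw [intervalIntegral.integral_eq_sub_of_hasDerivAt (fun s _ => hd (x, y) s)
      (hcont.intervalIntegrable _ _)]
    abel
  · intro t ht
    have h1 : ‖Gu (x, y) t‖ ≤ Cu := hCu ((x, y), t) (hmem t ht)
    linarith [le_abs_self Cu]
  · intro t ht
    have h1 : ‖Gφ (x, y) t‖ ≤ Cφ := hCφ ((x, y), t) (hmem t ht)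
    have hpos : 0 < |Cφ| / r + 2 := by linarith
    rw [interior_smul₀ hpos.ne', Set.mem_smul_set_iff_inv_smul_mem₀ hpos.ne']
    apply hrX
    rw [mem_ball_zero_iff, norm_smul, norm_inv, Real.norm_of_nonneg hpos.le,
      inv_mul_lt_iff₀ hpos, add_mul, div_mul_cancel₀ _ hr.ne']
    linarith [le_abs_self Cφ]
end

section
/- Consider the affine control system ẋ = Ax + Bu + a on ℝⁿ and n-dimensional polytopes X, X' with X ⊂ X'. If X'° ∩ 𝒪 = ∅, where 𝒪 := {x ∈ ℝⁿ : Ax + a ∈ Im(B)}, then the system is not relaxed in-block controllable (RIBC) with respect to X through X'. -/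
open Matrix Set Pointwise MeasureTheory

theorem sep_aux {n m : ℕ} (A : Matrix (Fin n) (Fin n) ℝ) (B : Matrix (Fin n) (Fin m) ℝ)
    (a : Fin n → ℝ) (K : Set (Fin n → ℝ)) (hK : IsOpen K) (hc : Convex ℝ K)
    (hO : K ∩ equilSet A B a = ∅) :
    K = ∅ ∨ ∃ p : (Fin n → ℝ) →L[ℝ] ℝ, p ≠ 0 ∧
      ∀ x ∈ K, ∀ u, 0 ≤ p (A.mulVec x + B.mulVec u + a) := by
  rcases K.eq_empty_or_nonempty with h | ⟨x0, hx0⟩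
  · exact Or.inl h
  right
  let L : ((Fin n → ℝ) × (Fin m → ℝ)) →ₗ[ℝ] (Fin n → ℝ) := A.mulVecLin.coprod B.mulVecLin
  have hL : ∀ x u, L (x, u) = A.mulVec x + B.mulVec u := fun x u => by
    simp [L]
  by_cases hW : LinearMap.range L = ⊤
  · have hs : Function.Surjective L := LinearMap.range_eq_top.1 hW
    have hop : IsOpenMap L := L.isOpenMap_of_finiteDimensional hs
    have hO1 : IsOpen (L '' (K ×ˢ univ)) := hop _ (hK.prod isOpen_univ)
    have hC1 : Convex ℝ (L '' (K ×ˢ univ)) := (hc.prod convex_univ).linear_image L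
    have hn : -a ∉ L '' (K ×ˢ univ) := by
      rintro ⟨⟨x, u⟩, ⟨hx, -⟩, h⟩
      rw [hL] at h
      have : x ∈ K ∩ equilSet A B a := ⟨hx, -u, by
        rw [Matrix.mulVec_neg]
        have : A.mulVec x = -a - B.mulVec u := by rw [← h]; abel
        rw [this]; abel⟩
      rw [hO] at this
      exact this
    obtain ⟨p, hp⟩ := geometric_hahn_banach_point_open hC1 hO1 hn
    have key : ∀ x ∈ K, ∀ u, 0 < p (A.mulVec x + B.mulVec u + a) := by
      intro x hx u
      have := hp _ ⟨(x, u), ⟨hx, mem_univ _⟩, rfl⟩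
      rw [hL, map_neg] at this
      rw [map_add p _ a]
      linarith
    refine ⟨p, ?_, fun x hx u => (key x hx u).le⟩
    rintro rfl
    simpa using key x0 hx0 0
  · obtain ⟨f, hf, hfk⟩ := Submodule.exists_le_ker_of_lt_top _ (lt_top_iff_ne_top.2 hW)
    let g : (Fin n → ℝ) →L[ℝ] ℝ := LinearMap.toContinuousLinearMap f
    have hg : g ≠ 0 := by
      intro h
      apply hf
      refine LinearMap.ext fun x => ?_
      exact congrArg (fun k : (Fin n → ℝ) →L[ℝ] ℝ => k x) h
    have hg0 : ∀ x u, g (A.mulVec x + B.mulVec u + a) = g a := by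
      intro x u
      rw [map_add, ← hL]
      have : g (L (x, u)) = 0 := hfk ⟨_, rfl⟩
      rw [this, zero_add]
    rcases le_total 0 (g a) with h | h
    · exact ⟨g, hg, fun x _ u => by rw [hg0]; exact h⟩
    · refine ⟨-g, neg_ne_zero.2 hg, fun x _ u => ?_⟩
      rw [_root_.neg_apply, hg0]
      linarith

/-- If `X'° ∩ 𝒪 = ∅`, then the affine system `ẋ = Ax + Bu + a`
is not RIBC w.r.t. `X` through `X'`. -/
theorem stmt1 {n m : ℕ} (A : Matrix (Fin n) (Fin n) ℝ) (B : Matrix (Fin n) (Fin m) ℝ)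
    (a : Fin n → ℝ) (hB : B.rank = m) (X X' : Set (Fin n → ℝ))
    (hX : IsNPolytope X) (hX' : IsNPolytope X') (hXX' : X ⊂ X')
    (hO : interior X' ∩ equilSet A B a = ∅) :
    ¬ RIBC A B a X X' := by
  rintro ⟨M, -, h⟩
  obtain ⟨V', rfl⟩ := hX'.1
  obtain ⟨x, hx⟩ := hX.2
  rcases sep_aux A B a _ isOpen_interior (convex_convexHull ℝ _).interior hO with h0 | ⟨p, hp, hpos⟩
  · exact (hX'.2.ne_empty h0).elim
  -- find `y ∈ X°` with `p y < p x`
  obtain ⟨v, hv⟩ : ∃ v, p v ≠ 0 := by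
    by_contra! hc
    exact hp (ContinuousLinearMap.ext hc)
  obtain ⟨w, hw⟩ : ∃ w, p w < 0 := by
    rcases lt_or_gt_of_ne hv with h1 | h1
    · exact ⟨v, h1⟩
    · exact ⟨-v, by rw [map_neg]; linarith⟩
  have hcont : Filter.Tendsto (fun t : ℝ => x + t • w) (nhdsWithin 0 (Ioi 0)) (nhds x) := by
    have : Continuous (fun t : ℝ => x + t • w) := by fun_prop
    have h2 := this.tendsto 0
    simp only [zero_smul, add_zero] at h2
    exact h2.mono_left nhdsWithin_le_nhds
  obtain ⟨t, hty, ht⟩ := ((hcont.eventually (isOpen_interior.mem_nhds hx)).and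
    self_mem_nhdsWithin).exists
  have hlt : p (x + t • w) < p x := by
    rw [map_add, map_smul, smul_eq_mul]
    have := mul_neg_of_pos_of_neg ht hw
    linarith
  obtain ⟨T, hT, u, φ, -, hsol, h0, h1, -, hin⟩ := h x hx _ hty
  have hs := hsol T ⟨hT, le_rfl⟩
  rw [h1, h0] at hs
  by_cases hi : IntervalIntegrable (fun s => A.mulVec (φ s) + B.mulVec (u s) + a) volume 0 T
  · have h3 : p (∫ s in (0 : ℝ)..T, (A.mulVec (φ s) + B.mulVec (u s) + a)) =
        ∫ s in (0 : ℝ)..T, p (A.mulVec (φ s) + B.mulVec (u s) + a) :=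
      (p.intervalIntegral_comp_comm hi).symm
    have h4 : 0 ≤ ∫ s in (0 : ℝ)..T, p (A.mulVec (φ s) + B.mulVec (u s) + a) :=
      intervalIntegral.integral_nonneg hT fun s hs => hpos _ (hin s hs) _
    rw [hs, map_add, h3] at hlt
    linarith
  · rw [intervalIntegral.integral_undef hi, add_zero] at hs
    rw [hs] at hlt
    exact lt_irrefl _ hlt
end

section
/- Consider the affine control system ẋ = Ax + Bu + a on ℝⁿ and n-dimensional polytopes X, X' with X ⊂ X'. Suppose there exists a vector β ∈ ℝⁿ with Bᵀβ = 0 and β·(Ax + Bu + a) < 0 for all x ∈ X'° and all u ∈ ℝ^m (equivalently, β·(Ax + a) < 0 for all x ∈ X'°). Then the system is not relaxed in-block controllable (RIBC) with respect to X through X'; in fact there exist x, y ∈ X° such that no admissible control steers the system from x to y while remaining in X'°. -/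
open Matrix Set Pointwise MeasureTheory

/-- If there is `β` with `Bᵀβ = 0` and `β·(Ax + Bu + a) < 0` on `X'°`, then the
system is not RIBC w.r.t. `X` through `X'`; in fact some `x, y ∈ X°` cannot be connected by any
admissible control whose trajectory remains in `X'°`. -/
theorem stmt2 {n m : ℕ} (A : Matrix (Fin n) (Fin n) ℝ) (B : Matrix (Fin n) (Fin m) ℝ)
    (a : Fin n → ℝ) (hB : B.rank = m) (X X' : Set (Fin n → ℝ))
    (hX : IsNPolytope X) (hX' : IsNPolytope X') (hXX' : X ⊂ X')
    (β : Fin n → ℝ) (hβB : B.transpose.mulVec β = 0)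
    (hβ : ∀ x ∈ interior X', ∀ u : Fin m → ℝ, β ⬝ᵥ (A.mulVec x + B.mulVec u + a) < 0) :
    ¬ RIBC A B a X X' ∧
    ∃ x ∈ interior X, ∃ y ∈ interior X,
      ¬ ∃ T ≥ (0 : ℝ), ∃ u : ℝ → Fin m → ℝ, ∃ φ : ℝ → Fin n → ℝ,
          Measurable u ∧ IsSol A B a u φ T ∧ φ 0 = x ∧ φ T = y ∧
          (∀ t ∈ Set.Icc (0 : ℝ) T, φ t ∈ interior X') := by
  have key : ∃ x ∈ interior X, ∃ y ∈ interior X,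
      ¬ ∃ T ≥ (0 : ℝ), ∃ u : ℝ → Fin m → ℝ, ∃ φ : ℝ → Fin n → ℝ,
          Measurable u ∧ IsSol A B a u φ T ∧ φ 0 = x ∧ φ T = y ∧
          (∀ t ∈ Set.Icc (0 : ℝ) T, φ t ∈ interior X') := by
    obtain ⟨x, hx⟩ := hX.2
    have hβ0 : β ≠ 0 := by
      rintro rfl
      have := hβ x (interior_mono hXX'.subset hx) 0
      simp at this
    have hpos : 0 < β ⬝ᵥ β := by
      refine lt_of_le_of_ne ?_ (fun h => hβ0 (dotProduct_self_eq_zero.mp h.symm))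
      exact Finset.sum_nonneg fun i _ => mul_self_nonneg _
    have hcont : Filter.Tendsto (fun e : ℝ => x + e • β) (nhdsWithin 0 (Set.Ioi 0))
        (nhds x) := by
      have : Continuous (fun e : ℝ => x + e • β) := by fun_prop
      have h := this.tendsto 0
      simp only [zero_smul, add_zero] at h
      exact h.mono_left nhdsWithin_le_nhds
    obtain ⟨e, he, he0⟩ := ((hcont.eventually (isOpen_interior.mem_nhds hx)).and
      self_mem_nhdsWithin).exists
    have he0' : 0 < e := he0
    refine ⟨x, hx, x + e • β, he, ?_⟩
    rintro ⟨T, hT, u, φ, -, hsol, h0, h1, hin⟩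
    have hs := hsol T ⟨hT, le_rfl⟩
    rw [h0, h1] at hs
    have hs := add_left_cancel hs
    have hlt : 0 < β ⬝ᵥ (e • β) := by
      rw [dotProduct_smul, smul_eq_mul]; positivity
    rw [hs] at hlt
    by_cases hi : IntervalIntegrable
        (fun s => A.mulVec (φ s) + B.mulVec (u s) + a) volume 0 T
    · let L : (Fin n → ℝ) →L[ℝ] ℝ := LinearMap.toContinuousLinearMap
        { toFun := fun v => β ⬝ᵥ v
          map_add' := fun v w => dotProduct_add β v w
          map_smul' := fun c v => dotProduct_smul c β v }
      have hL : ∀ v, L v = β ⬝ᵥ v := fun v => rfl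
      rw [← hL, ← L.intervalIntegral_comp_comm hi] at hlt
      have : 0 ≤ ∫ s in (0 : ℝ)..T, -L (A.mulVec (φ s) + B.mulVec (u s) + a) := by
        refine intervalIntegral.integral_nonneg hT fun s hs => ?_
        rw [hL]
        have := hβ (φ s) (hin s hs) (u s)
        linarith
      rw [intervalIntegral.integral_neg] at this
      linarith
    · rw [intervalIntegral.integral_undef hi] at hlt
      simp at hlt
  refine ⟨?_, key⟩
  rintro ⟨M, -, h⟩
  obtain ⟨x, hx, y, hy, hxy⟩ := key
  obtain ⟨T, hT, u, φ, h1, h2, h3, h4, -, h5⟩ := h x hx y hy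
  exact hxy ⟨T, hT, u, φ, h1, h2, h3, h4, h5⟩
end

section
/- Consider the linear control system ẋ = Ax + Bu on ℝⁿ and n-dimensional polytopes X, X' such that 0 ∈ X° ⊂ X'°. If the system is relaxed in-block controllable (RIBC) with respect to X through X', then the pair (A,B) is controllable, i.e., rank [B AB ⋯ A^{n−1}B] = n. -/
open Matrix Set Pointwise MeasureTheory

theorem aux_zero {E : Type*} [NormedAddCommGroup E] [NormedSpace ℝ E] [CompleteSpace E]
    (F : E →L[ℝ] E) (W : E →L[ℝ] ℝ) (φ b : ℝ → E) (T R : ℝ) (hT : 0 ≤ T)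
    (hint : IntervalIntegrable (fun s => F (φ s) + b s) volume 0 T)
    (hφ : ∀ t ∈ Set.Icc (0 : ℝ) T, φ t = ∫ s in (0 : ℝ)..t, (F (φ s) + b s))
    (hb : ∀ (j : ℕ) s, W ((F ^ j) (b s)) = 0)
    (hR : ∀ t ∈ Set.Icc (0 : ℝ) T, ‖φ t‖ ≤ R) : W (φ T) = 0 := by
  have hrec : ∀ (j : ℕ), ∀ t ∈ Set.Icc (0 : ℝ) T,
      W ((F ^ j) (φ t)) = ∫ s in (0 : ℝ)..t, W ((F ^ (j + 1)) (φ s)) := by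
    intro j t ht
    have hi : IntervalIntegrable (fun s => F (φ s) + b s) volume 0 t :=
      hint.mono_set (by
        rw [uIcc_of_le ht.1, uIcc_of_le hT]
        exact Icc_subset_Icc_right ht.2)
    have h1 := (W.comp (F ^ j)).intervalIntegral_comp_comm hi
    have h2 : W ((F ^ j) (φ t)) = (W.comp (F ^ j)) (∫ s in (0 : ℝ)..t, (F (φ s) + b s)) := by
      rw [← hφ t ht]; rfl
    rw [h2, ← h1]
    congr 1
    ext s
    simp only [ContinuousLinearMap.comp_apply, map_add, hb, add_zero]
    rw [pow_succ]; rfl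
  have hbound : ∀ (k j : ℕ), ∀ t ∈ Set.Icc (0 : ℝ) T,
      ‖W ((F ^ j) (φ t))‖ ≤ ‖W‖ * R * ‖F‖ ^ (j + k) * (t ^ k / (k.factorial : ℝ)) := by
    intro k
    induction k with
    | zero =>
      intro j t ht
      have hp : ‖(F ^ j) (φ t)‖ ≤ ‖F‖ ^ j * ‖φ t‖ := by
        induction j with
        | zero => simp
        | succ j ih =>
          rw [pow_succ']
          calc ‖F ((F ^ j) (φ t))‖ ≤ ‖F‖ * ‖(F ^ j) (φ t)‖ := F.le_opNorm _
            _ ≤ ‖F‖ * (‖F‖ ^ j * ‖φ t‖) := by gcongr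
            _ = _ := by ring
      calc ‖W ((F ^ j) (φ t))‖ ≤ ‖W‖ * ‖(F ^ j) (φ t)‖ := W.le_opNorm _
        _ ≤ ‖W‖ * (‖F‖ ^ j * R) := by
          have := hR t ht
          gcongr
          exact hp.trans (by gcongr)
        _ = _ := by simp; ring
    | succ k ih =>
      intro j t ht
      rw [hrec j t ht]
      have := intervalIntegral.norm_integral_le_of_norm_le (μ := volume) (a := 0) (b := t)
        (f := fun s => W ((F ^ (j + 1)) (φ s)))
        (g := fun s => ‖W‖ * R * ‖F‖ ^ (j + 1 + k) * (s ^ k / (k.factorial : ℝ))) ht.1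
        (Filter.Eventually.of_forall fun s hs => ih (j + 1) s ⟨hs.1.le, hs.2.trans ht.2⟩)
        (Continuous.intervalIntegrable (by fun_prop) _ _)
      refine this.trans (le_of_eq ?_)
      rw [intervalIntegral.integral_const_mul, intervalIntegral.integral_div, integral_pow]
      rw [Nat.factorial_succ]
      push_cast
      rw [show j + 1 + k = j + (k + 1) by ring]
      have : (k.factorial : ℝ) ≠ 0 := by positivity
      have : (k : ℝ) + 1 ≠ 0 := by positivity
      field_simp
      simp
  have hlim : Filter.Tendsto (fun k : ℕ => ‖W‖ * R * ((‖F‖ * T) ^ k / (k.factorial : ℝ)))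
      Filter.atTop (nhds 0) := by
    simpa using (FloorSemiring.tendsto_pow_div_factorial_atTop (‖F‖ * T)).const_mul (‖W‖ * R)
  have : ‖W (φ T)‖ ≤ 0 := by
    refine ge_of_tendsto' hlim fun k => ?_
    have := hbound k 0 T ⟨hT, le_rfl⟩
    simp only [pow_zero, zero_add] at this
    refine this.trans (le_of_eq ?_)
    rw [mul_pow]; ring
  exact norm_le_zero_iff.mp this

theorem aux_ch {n m : ℕ} (A : Matrix (Fin n) (Fin n) ℝ) (B : Matrix (Fin n) (Fin m) ℝ)
    (w : Fin n → ℝ) (hw : w ᵥ* ctrbMat A B = 0) (k : ℕ) : w ᵥ* (A ^ k * B) = 0 := by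
  have hlt : ∀ i < n, w ᵥ* (A ^ i * B) = 0 := by
    intro i hi
    ext j
    exact congrFun hw (⟨i, hi⟩, j)
  rcases Nat.eq_zero_or_pos n with rfl | hn
  · ext j; simp [vecMul, dotProduct]
  rw [Matrix.pow_eq_aeval_mod_charpoly]
  have hd : (Polynomial.X ^ k %ₘ A.charpoly).natDegree < n := by
    have := Polynomial.natDegree_modByMonic_lt (Polynomial.X ^ k) A.charpoly_monic (by
      intro h
      have := A.charpoly_natDegree_eq_dim
      rw [h] at this
      simp at this
      omega)
    rwa [A.charpoly_natDegree_eq_dim, Fintype.card_fin] at this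
  rw [Polynomial.aeval_eq_sum_range' hd, Matrix.sum_mul, Matrix.vecMul_sum]
  refine Finset.sum_eq_zero fun i hi => ?_
  rw [Matrix.smul_mul, Matrix.vecMul_smul, hlt i (Finset.mem_range.mp hi), smul_zero]

/-- For the linear system `ẋ = Ax + Bu` with `0 ∈ X° ⊂ X'°`, RIBC w.r.t. `X`
through `X'` implies that `(A,B)` is controllable. -/
theorem stmt3 {n m : ℕ} (A : Matrix (Fin n) (Fin n) ℝ) (B : Matrix (Fin n) (Fin m) ℝ)
    (hB : B.rank = m) (X X' : Set (Fin n → ℝ))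
    (hX : IsNPolytope X) (hX' : IsNPolytope X')
    (h0 : (0 : Fin n → ℝ) ∈ interior X) (hXX' : interior X ⊂ interior X')
    (hRIBC : RIBC A B 0 X X') :
    Controllable A B := by
  obtain ⟨M, hM, hR⟩ := hRIBC
  suffices hinj : Function.Injective (ctrbMat A B).vecMul by
    have := (Matrix.vecMul_injective_iff.mp hinj).rank_matrix
    rw [Fintype.card_fin] at this
    exact this
  suffices hz : ∀ w, w ᵥ* ctrbMat A B = 0 → w = 0 by
    intro v v' h
    refine sub_eq_zero.mp (hz _ ?_)
    rw [Matrix.sub_vecMul]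
    exact sub_eq_zero.mpr h
  intro w hw
  by_contra hw0
  have hch := aux_ch A B w hw
  -- a small multiple of w in the interior of X
  obtain ⟨ε, hε, hεX⟩ : ∃ ε : ℝ, 0 < ε ∧ ε • w ∈ interior X := by
    have hc : Filter.Tendsto (fun ε : ℝ => ε • w) (nhdsWithin 0 (Set.Ioi 0)) (nhds 0) := by
      have : Continuous fun ε : ℝ => ε • w := by fun_prop
      have h := this.tendsto 0
      rw [zero_smul] at h
      exact h.mono_left nhdsWithin_le_nhds
    have h1 := hc.eventually (isOpen_interior.mem_nhds h0)
    obtain ⟨ε, h, h'⟩ := (h1.and self_mem_nhdsWithin).exists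
    exact ⟨ε, h', h⟩
  obtain ⟨T, hT, u, φ, hu, hsol, hφ0, hφT, huM, hφX⟩ := hR 0 h0 _ hεX
  have hbdd : Bornology.IsBounded X' := by
    obtain ⟨⟨V, rfl⟩, -⟩ := hX'
    exact isBounded_convexHull.mpr V.finite_toSet.isBounded
  obtain ⟨R, hRb⟩ := hbdd.exists_norm_le
  let F : (Fin n → ℝ) →L[ℝ] (Fin n → ℝ) := LinearMap.toContinuousLinearMap A.mulVecLin
  let W : (Fin n → ℝ) →L[ℝ] ℝ := LinearMap.toContinuousLinearMap
    { toFun := fun z => w ⬝ᵥ z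
      map_add' := fun x y => dotProduct_add _ _ _
      map_smul' := fun c x => dotProduct_smul _ _ _ }
  have hF : ∀ z, F z = A *ᵥ z := fun z => rfl
  have hW : ∀ z, W z = w ⬝ᵥ z := fun z => rfl
  have hFp : ∀ (j : ℕ) z, (F ^ j) z = (A ^ j) *ᵥ z := by
    intro j
    induction j with
    | zero => intro z; simp
    | succ j ih =>
      intro z
      rw [pow_succ, pow_succ, ← Matrix.mulVec_mulVec, ← ih, ← hF]; rfl
  have hsol' : ∀ t ∈ Set.Icc (0 : ℝ) T,
      φ t = ∫ s in (0 : ℝ)..t, (F (φ s) + B *ᵥ (u s)) := by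
    intro t ht
    have := hsol t ht
    rw [hφ0] at this
    simpa [hF] using this
  have hTT : T ∈ Set.Icc (0 : ℝ) T := ⟨hT, le_rfl⟩
  have hint : IntervalIntegrable (fun s => F (φ s) + B *ᵥ (u s)) volume 0 T := by
    by_contra hni
    have := hsol' T hTT
    rw [intervalIntegral.integral_undef hni, hφT] at this
    exact (smul_ne_zero hε.ne' hw0) this
  have key := aux_zero F W φ (fun s => B *ᵥ (u s)) T R hT hint hsol' (by
      intro j s
      rw [hFp, hW, Matrix.mulVec_mulVec, Matrix.dotProduct_mulVec, hch, zero_dotProduct])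
    (fun t ht => hRb _ (interior_subset (hφX t ht)))
  rw [hφT, hW, dotProduct_smul, smul_eq_mul, mul_eq_zero] at key
  exact key.elim hε.ne' fun h => hw0 (dotProduct_self_eq_zero.mp h)
end

section
/- Consider the linear control system ẋ = Ax + Bu on ℝⁿ and n-dimensional polytopes X, X' such that 0 ∈ X° ⊂ X'°. If the system is relaxed in-block controllable (RIBC) with respect to X through X', then there exists an n-dimensional compact convex set X₂ with X ⊆ X₂ ⊆ X' such that the backward invariance conditions of X₂ are solvable: for each x ∈ ∂X₂ there exists u ∈ ℝ^m with −Ax − Bu ∈ T_{X₂}(x), the Bouligand tangent cone to X₂ at x. -/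
open Matrix Set Pointwise MeasureTheory

/-- Integrability of the right-hand side along a bounded integral solution. -/
lemma aux_integrable {E : Type*} [NormedAddCommGroup E] [NormedSpace ℝ E]
    [MeasurableSpace E] [BorelSpace E] [SecondCountableTopology E]
    (L : E →L[ℝ] E) (g φ : ℝ → E) (hg : Measurable g) (T C : ℝ) (hT : 0 ≤ T)
    (hC : ∀ t ∈ Set.Icc (0 : ℝ) T, ‖L (φ t) + g t‖ ≤ C)
    (hsol : ∀ t ∈ Set.Icc (0 : ℝ) T, φ t = φ 0 + ∫ s in (0 : ℝ)..t, (L (φ s) + g s)) :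
    IntervalIntegrable (fun s => L (φ s) + g s) volume 0 T := by
  set f : ℝ → E := fun s => L (φ s) + g s with hf
  have key : ∀ a b : ℝ, 0 ≤ a → a ≤ b → b ≤ T →
      AEStronglyMeasurable f (volume.restrict (Set.Ioc a b)) → IntervalIntegrable f volume a b := by
    intro a b ha hab hb hm
    rw [intervalIntegrable_iff_integrableOn_Ioc_of_le hab]
    refine IntegrableOn.of_bound (C := C) (by simp) hm ?_
    filter_upwards [ae_restrict_mem measurableSet_Ioc] with t ht
    exact hC t ⟨ha.trans ht.1.le, ht.2.trans hb⟩
  set S : Set ℝ := {t | t ∈ Set.Icc (0 : ℝ) T ∧ IntervalIntegrable f volume 0 t} with hS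
  have h0S : (0 : ℝ) ∈ S := ⟨⟨le_rfl, hT⟩, by simp⟩
  have hbdd : BddAbove S := ⟨T, fun t ht => ht.1.2⟩
  set τ := sSup S with hτ
  have hτ0 : 0 ≤ τ := le_csSup hbdd h0S
  have hτT : τ ≤ T := csSup_le ⟨0, h0S⟩ fun t ht => ht.1.2
  have hm1 : AEStronglyMeasurable f (volume.restrict (Set.Ioc 0 τ)) := by
    have hU : ∀ k : ℕ, AEStronglyMeasurable f
        (volume.restrict (Set.Ioc 0 (τ - 1 / ((k : ℝ) + 1)))) := by
      intro k
      have hk : τ - 1 / ((k : ℝ) + 1) < τ := by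
        have : 0 < 1 / ((k : ℝ) + 1) := by positivity
        linarith
      obtain ⟨s, hs, hs'⟩ := exists_lt_of_lt_csSup ⟨0, h0S⟩ hk
      have := (intervalIntegrable_iff_integrableOn_Ioc_of_le hs.1.1).1 hs.2
      exact (this.mono_set (Set.Ioc_subset_Ioc le_rfl hs'.le)).aestronglyMeasurable
    have hU2 := (aestronglyMeasurable_iUnion_iff).2 hU
    have hsub : Set.Ioo 0 τ ⊆ ⋃ k : ℕ, Set.Ioc 0 (τ - 1 / ((k : ℝ) + 1)) := by
      intro s hs
      obtain ⟨k, hk⟩ := exists_nat_one_div_lt (sub_pos.2 hs.2)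
      exact Set.mem_iUnion.2 ⟨k, hs.1, by linarith⟩
    have := hU2.mono_measure (Measure.restrict_mono_set volume hsub)
    rwa [Measure.restrict_congr_set Ioo_ae_eq_Ioc] at this
  have hm2 : AEStronglyMeasurable f (volume.restrict (Set.Ioc τ T)) := by
    have : AEStronglyMeasurable (fun s => L (φ 0) + g s) (volume.restrict (Set.Ioc τ T)) :=
      (measurable_const.add hg).aestronglyMeasurable
    refine this.congr ?_
    filter_upwards [ae_restrict_mem measurableSet_Ioc] with t ht
    have htI : t ∈ Set.Icc (0 : ℝ) T := ⟨hτ0.trans ht.1.le, ht.2⟩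
    have hn : ¬ IntervalIntegrable f volume 0 t := fun h =>
      absurd (le_csSup hbdd (show t ∈ S from ⟨htI, h⟩)) (not_le.2 ht.1)
    have := hsol t htI
    rw [intervalIntegral.integral_undef hn, add_zero] at this
    simp [hf, this]
  exact (key 0 τ le_rfl hτ0 hτT hm1).trans (key τ T hτ0 hτT le_rfl hm2)

/-- One backward step of Euler type along a solution starting at `0`. -/
lemma aux_step {n m : ℕ} (LA : (Fin n → ℝ) →L[ℝ] (Fin n → ℝ))
    (LB : (Fin m → ℝ) →L[ℝ] (Fin n → ℝ))
    (u : ℝ → Fin m → ℝ) (hu : Measurable u) (φ : ℝ → Fin n → ℝ) (T M C : ℝ) (hT : 0 ≤ T)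
    (hM : 0 ≤ M)
    (hC : ∀ t ∈ Set.Icc (0 : ℝ) T, ‖LA (φ t) + LB (u t)‖ ≤ C) (h0 : φ 0 = 0)
    (huM : ∀ t ∈ Set.Icc (0 : ℝ) T, ‖u t‖ ≤ M)
    (hsol : ∀ t ∈ Set.Icc (0 : ℝ) T, φ t = φ 0 + ∫ s in (0 : ℝ)..t, (LA (φ s) + LB (u s)))
    (t : ℝ) (ht : 0 < t) :
    ∃ r ∈ Set.Icc (0 : ℝ) T, ∃ w : Fin m → ℝ, ‖w‖ ≤ M ∧
      ‖φ T - t • LA (φ T) - t • LB w - φ r‖ ≤ 2 * ‖LA‖ * C * t ^ 2 := by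
  have hint := aux_integrable LA (fun s => LB (u s)) φ (LB.measurable.comp hu) T C hT hC hsol
  have hC0 : 0 ≤ C := (norm_nonneg _).trans (hC 0 ⟨le_rfl, hT⟩)
  have hsub : ∀ a ∈ Set.Icc (0 : ℝ) T, ∀ b ∈ Set.Icc (0 : ℝ) T,
      IntervalIntegrable (fun s => LA (φ s) + LB (u s)) volume a b := by
    intro a ha b hb
    refine hint.mono_set ?_
    rw [Set.uIcc_of_le hT]
    exact Set.uIcc_subset_Icc ha hb
  have hdiff : ∀ a ∈ Set.Icc (0 : ℝ) T, ∀ b ∈ Set.Icc (0 : ℝ) T,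
      φ b - φ a = ∫ s in a..b, (LA (φ s) + LB (u s)) := by
    intro a ha b hb
    rw [hsol a ha, hsol b hb, add_sub_add_left_eq_sub]
    exact intervalIntegral.integral_interval_sub_left (hsub 0 ⟨le_rfl, hT⟩ b hb)
      (hsub 0 ⟨le_rfl, hT⟩ a ha)
  have hlip : ∀ a ∈ Set.Icc (0 : ℝ) T, ∀ b ∈ Set.Icc (0 : ℝ) T, a ≤ b →
      ‖φ b - φ a‖ ≤ C * (b - a) := by
    intro a ha b hb hab
    rw [hdiff a ha b hb, ← abs_of_nonneg (sub_nonneg.2 hab)]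
    refine intervalIntegral.norm_integral_le_of_norm_le_const ?_
    intro s hs
    rw [Set.uIoc_of_le hab] at hs
    exact hC s ⟨ha.1.trans hs.1.le, hs.2.trans hb.2⟩
  set τ := min t T with hτ
  have hτ0 : 0 ≤ τ := le_min ht.le hT
  have hτt : τ ≤ t := min_le_left _ _
  have hτT : τ ≤ T := min_le_right _ _
  have hr : T - τ ∈ Set.Icc (0 : ℝ) T := ⟨by linarith, by linarith⟩
  have hTT : T ∈ Set.Icc (0 : ℝ) T := ⟨hT, le_rfl⟩
  have hui : IntervalIntegrable u volume (T - τ) T := by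
    rw [intervalIntegrable_iff_integrableOn_Ioc_of_le hr.2]
    refine Measure.integrableOn_of_bounded (M := M) (by simp) hu.aestronglyMeasurable ?_
    filter_upwards [ae_restrict_mem measurableSet_Ioc] with s hs
    exact huM s ⟨hr.1.trans hs.1.le, hs.2⟩
  have hBui : IntervalIntegrable (fun s => LB (u s)) volume (T - τ) T :=
    ⟨LB.integrable_comp hui.1, LB.integrable_comp hui.2⟩
  have hAi : IntervalIntegrable (fun s => LA (φ s)) volume (T - τ) T := by
    have := (hsub _ hr _ hTT).sub hBui
    refine this.congr ?_
    intro s _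
    simp
  refine ⟨T - τ, hr, t⁻¹ • ∫ s in (T - τ)..T, u s, ?_, ?_⟩
  · rw [norm_smul, norm_inv, Real.norm_of_nonneg ht.le]
    have : ‖∫ s in (T - τ)..T, u s‖ ≤ M * |T - (T - τ)| := by
      refine intervalIntegral.norm_integral_le_of_norm_le_const ?_
      intro s hs
      rw [Set.uIoc_of_le hr.2] at hs
      exact huM s ⟨hr.1.trans hs.1.le, hs.2⟩
    rw [sub_sub_cancel, abs_of_nonneg hτ0] at this
    rw [inv_mul_le_iff₀ ht]
    nlinarith
  · have hB1 : t • LB (t⁻¹ • ∫ s in (T - τ)..T, u s) = ∫ s in (T - τ)..T, LB (u s) := by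
      rw [map_smul, smul_inv_smul₀ ht.ne', LB.intervalIntegral_comp_comm hui]
    have e1 := hdiff _ hr _ hTT
    rw [intervalIntegral.integral_add hAi hBui] at e1
    have e2 : ∫ s in (T - τ)..T, (LA (φ s) - LA (φ T)) =
        (∫ s in (T - τ)..T, LA (φ s)) - τ • LA (φ T) := by
      rw [intervalIntegral.integral_sub hAi (by simp), intervalIntegral.integral_const,
        sub_sub_cancel]
    have e3 : φ T - t • LA (φ T) - t • LB (t⁻¹ • ∫ s in (T - τ)..T, u s) - φ (T - τ) =
        (∫ s in (T - τ)..T, (LA (φ s) - LA (φ T))) - (t - τ) • LA (φ T) := by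
      rw [hB1, e2, sub_smul]
      have : φ T = φ (T - τ) + ((∫ s in (T - τ)..T, LA (φ s)) + ∫ s in (T - τ)..T, LB (u s)) := by
        rw [← e1]; abel
      generalize LA (φ T) = z
      rw [this]; abel
    rw [e3]
    have b1 : ‖∫ s in (T - τ)..T, (LA (φ s) - LA (φ T))‖ ≤ (‖LA‖ * (C * τ)) * |T - (T - τ)| := by
      refine intervalIntegral.norm_integral_le_of_norm_le_const ?_
      intro s hs
      rw [Set.uIoc_of_le hr.2] at hs
      rw [← map_sub]
      refine (LA.le_opNorm _).trans ?_
      rw [norm_sub_rev]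
      refine mul_le_mul_of_nonneg_left ?_ (norm_nonneg _)
      refine (hlip s ⟨hr.1.trans hs.1.le, hs.2⟩ T hTT hs.2).trans ?_
      exact mul_le_mul_of_nonneg_left (by linarith [hs.1]) hC0
    rw [sub_sub_cancel, abs_of_nonneg hτ0] at b1
    have b2 : ‖(t - τ) • LA (φ T)‖ ≤ (t - τ) * (‖LA‖ * (C * T)) := by
      rw [norm_smul, Real.norm_of_nonneg (by linarith)]
      refine mul_le_mul_of_nonneg_left ?_ (by linarith)
      refine (LA.le_opNorm _).trans (mul_le_mul_of_nonneg_left ?_ (norm_nonneg _))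
      have := hlip 0 ⟨le_rfl, hT⟩ T hTT hT
      simpa [h0] using this
    have b3 : (t - τ) * T ≤ t ^ 2 := by
      rcases le_total t T with h | h
      · rw [hτ, min_eq_left h]; simp; positivity
      · rw [hτ, min_eq_right h]; nlinarith
    have b4 : τ * τ ≤ t ^ 2 := by nlinarith
    have hK : 0 ≤ ‖LA‖ * C := by positivity
    calc _ ≤ _ := norm_sub_le _ _
      _ ≤ (‖LA‖ * (C * τ)) * τ + (t - τ) * (‖LA‖ * (C * T)) := add_le_add b1 b2
      _ = (‖LA‖ * C) * (τ * τ) + (‖LA‖ * C) * ((t - τ) * T) := by ring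
      _ ≤ (‖LA‖ * C) * t ^ 2 + (‖LA‖ * C) * t ^ 2 := by gcongr
      _ = _ := by ring

/-- From approximate backward steps to tangency. -/
lemma aux_tangent {n m : ℕ} (LA : (Fin n → ℝ) →L[ℝ] (Fin n → ℝ))
    (LB : (Fin m → ℝ) →L[ℝ] (Fin n → ℝ)) (X : Set (Fin n → ℝ)) (M K : ℝ) (hK : 0 ≤ K)
    (x : Fin n → ℝ)
    (h : ∀ t : ℝ, 0 < t → ∃ w : Fin m → ℝ, ‖w‖ ≤ M ∧ ∃ y ∈ X,
      ‖x - t • LA x - t • LB w - y‖ ≤ K * t ^ 2) :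
    ∃ u : Fin m → ℝ, -(LA x) - LB u ∈ bouligand X x := by
  have hpos : ∀ k : ℕ, 0 < 1 / ((k : ℝ) + 1) := fun k => by positivity
  choose w hw y hy hwy using fun k : ℕ => h (1 / ((k : ℝ) + 1)) (hpos k)
  obtain ⟨v, -, ψ, hψ, hlim⟩ := (isCompact_closedBall (0 : Fin m → ℝ) M).tendsto_subseq
    (x := w) (fun k => by simpa using hw k)
  refine ⟨v, ?_⟩
  set q : ℝ → ℝ := fun t => Metric.infDist (x + t • (-(LA x) - LB v)) X / t with hq
  have hnn : ∀ᶠ t in nhdsWithin (0 : ℝ) (Set.Ioi 0), 0 ≤ q t := by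
    filter_upwards [self_mem_nhdsWithin] with t ht
    exact div_nonneg Metric.infDist_nonneg (le_of_lt ht)
  have ht0 : Filter.Tendsto (fun k : ℕ => 1 / (((ψ k : ℕ) : ℝ) + 1)) Filter.atTop
      (nhds (0 : ℝ)) := tendsto_one_div_add_atTop_nhds_zero_nat.comp hψ.tendsto_atTop
  have ht0' : Filter.Tendsto (fun k : ℕ => 1 / (((ψ k : ℕ) : ℝ) + 1)) Filter.atTop
      (nhdsWithin (0 : ℝ) (Set.Ioi 0)) :=
    tendsto_nhdsWithin_iff.2 ⟨ht0, Filter.Eventually.of_forall fun k => hpos (ψ k)⟩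
  have hbound : ∀ k : ℕ, q (1 / (((ψ k : ℕ) : ℝ) + 1)) ≤
      K * (1 / (((ψ k : ℕ) : ℝ) + 1)) + ‖LB (w (ψ k) - v)‖ := by
    intro k
    have hp := hpos (ψ k)
    have h1 := hwy (ψ k)
    generalize (1 / (((ψ k : ℕ) : ℝ) + 1)) = t at hp h1 ⊢
    rw [hq]
    simp only
    rw [div_le_iff₀ hp]
    refine (Metric.infDist_le_dist_of_mem (hy (ψ k))).trans ?_
    rw [dist_eq_norm]
    have e : x + t • (-(LA x) - LB v) - y (ψ k) =
        (x - t • LA x - t • LB (w (ψ k)) - y (ψ k)) + t • LB (w (ψ k) - v) := by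
      rw [map_sub, smul_sub, smul_sub, smul_neg]; abel
    rw [e]
    refine (norm_add_le _ _).trans ?_
    rw [norm_smul, Real.norm_of_nonneg hp.le]
    nlinarith
  have hlim2 : Filter.Tendsto (fun k : ℕ => K * (1 / (((ψ k : ℕ) : ℝ) + 1)) +
      ‖LB (w (ψ k) - v)‖) Filter.atTop (nhds 0) := by
    have h1 : Filter.Tendsto (fun k : ℕ => ‖LB (w (ψ k) - v)‖) Filter.atTop (nhds 0) := by
      have : Filter.Tendsto (fun k : ℕ => ‖LB ((w ∘ ψ) k - v)‖) Filter.atTop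
          (nhds ‖LB (v - v)‖) :=
        ((LB.continuous.tendsto _).comp (hlim.sub_const v)).norm
      simpa using this
    simpa using (ht0.const_mul K).add h1
  have hfreq : ∀ ε : ℝ, 0 < ε → ∃ᶠ t in nhdsWithin (0 : ℝ) (Set.Ioi 0), q t ≤ ε := by
    intro ε hε
    refine ht0'.frequently (Filter.Eventually.frequently ?_)
    filter_upwards [hlim2.eventually (gt_mem_nhds hε)] with k hk
    exact (hbound k).trans hk.le
  have hbd : Filter.IsBoundedUnder (· ≥ ·) (nhdsWithin (0 : ℝ) (Set.Ioi 0)) q := ⟨0, hnn⟩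
  show Filter.liminf q (nhdsWithin 0 (Set.Ioi 0)) = 0
  apply le_antisymm
  · refine le_of_forall_pos_le_add fun ε hε => ?_
    rw [zero_add]
    exact Filter.liminf_le_of_frequently_le (hfreq ε hε) hbd
  · exact Filter.le_liminf_of_le (Filter.IsCoboundedUnder.of_frequently_le (hfreq 1 one_pos)) hnn

/-- For the linear system with `0 ∈ X° ⊂ X'°`, RIBC w.r.t. `X` through `X'`
implies there is an `n`-dimensional compact convex set `X₂` with `X ⊆ X₂ ⊆ X'` whose
backward invariance conditions are solvable. -/
theorem stmt5 {n m : ℕ} (A : Matrix (Fin n) (Fin n) ℝ) (B : Matrix (Fin n) (Fin m) ℝ)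
    (hB : B.rank = m) (X X' : Set (Fin n → ℝ))
    (hX : IsNPolytope X) (hX' : IsNPolytope X')
    (h0 : (0 : Fin n → ℝ) ∈ interior X) (hXX' : interior X ⊂ interior X')
    (hRIBC : RIBC A B 0 X X') :
    ∃ X₂ : Set (Fin n → ℝ), IsCompact X₂ ∧ Convex ℝ X₂ ∧ (interior X₂).Nonempty ∧
      X ⊆ X₂ ∧ X₂ ⊆ X' ∧
      ∀ x ∈ frontier X₂, ∃ u : Fin m → ℝ,
        -(A.mulVec x) - B.mulVec u ∈ bouligand X₂ x := by
  obtain ⟨M, hM, hR⟩ := hRIBC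
  obtain ⟨⟨V, hV⟩, -⟩ := hX
  obtain ⟨⟨V', hV'⟩, -⟩ := hX'
  have hXc : Convex ℝ X := hV ▸ convex_convexHull ℝ _
  have hXc' : Convex ℝ X' := hV' ▸ convex_convexHull ℝ _
  have hXk' : IsCompact X' := hV' ▸ V'.finite_toSet.isCompact_convexHull ℝ
  set LA : (Fin n → ℝ) →L[ℝ] (Fin n → ℝ) := LinearMap.toContinuousLinearMap A.mulVecLin with hLA
  set LB : (Fin m → ℝ) →L[ℝ] (Fin n → ℝ) := LinearMap.toContinuousLinearMap B.mulVecLin with hLB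
  have hLA' : ∀ x, LA x = A.mulVec x := fun x => rfl
  have hLB' : ∀ x, LB x = B.mulVec x := fun x => rfl
  obtain ⟨R, hR'⟩ := hXk'.isBounded.exists_norm_le
  have hR0 : 0 ≤ R := (norm_nonneg _).trans (hR' 0 (interior_subset (hXX'.1 h0)))
  set C : ℝ := ‖LA‖ * R + ‖LB‖ * M with hC
  have hC0 : 0 ≤ C := by positivity
  set S : Set (Fin n → ℝ) := {x | ∃ T ≥ (0 : ℝ), ∃ u : ℝ → Fin m → ℝ, ∃ φ : ℝ → Fin n → ℝ,
      Measurable u ∧ IsSol A B 0 u φ T ∧ φ 0 = 0 ∧ φ T = x ∧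
      (∀ t ∈ Set.Icc (0 : ℝ) T, ‖u t‖ ≤ M) ∧
      (∀ t ∈ Set.Icc (0 : ℝ) T, φ t ∈ interior X')} with hS
  have hXS : interior X ⊆ S := fun y hy => hR 0 h0 y hy
  have hSX' : S ⊆ X' := by
    rintro x ⟨T, hT, u, φ, -, -, -, rfl, -, h⟩
    exact interior_subset (h T ⟨hT, le_rfl⟩)
  set X₂ := closure (convexHull ℝ S) with hX₂
  have hX₂c : Convex ℝ X₂ := (convex_convexHull ℝ S).closure
  have hX₂X' : X₂ ⊆ X' := closure_minimal (convexHull_min hSX' hXc') hXk'.isClosed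
  have hX₂k : IsCompact X₂ := hXk'.of_isClosed_subset isClosed_closure hX₂X'
  have hSX₂ : S ⊆ X₂ := (subset_convexHull ℝ S).trans subset_closure
  have hXX₂ : X ⊆ X₂ := by
    refine subset_closure.trans ?_
    rw [← hXc.closure_interior_eq_closure_of_nonempty_interior ⟨0, h0⟩]
    exact closure_minimal (hXS.trans hSX₂) isClosed_closure
  refine ⟨X₂, hX₂k, hX₂c, ⟨0, interior_mono hXX₂ h0⟩, hXX₂, hX₂X', ?_⟩
  intro x hx
  have hxX₂ : x ∈ X₂ := isClosed_closure.frontier_subset hx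
  set K := 2 * ‖LA‖ * C with hKdef
  have hK : 0 ≤ K := by positivity
  refine aux_tangent LA LB X₂ M K hK x ?_
  intro t ht
  set P : (Fin n → ℝ) →L[ℝ] (Fin n → ℝ) := ContinuousLinearMap.id ℝ _ - t • LA with hP
  set Q : Set (Fin n → ℝ) := (t • LB) '' Metric.closedBall 0 M + X₂ +
    Metric.closedBall 0 (K * t ^ 2) with hQ
  have hQk : IsCompact Q :=
    (((isCompact_closedBall _ _).image (t • LB).continuous).add hX₂k).add (isCompact_closedBall _ _)
  have hQc : Convex ℝ Q :=
    (((convex_closedBall _ _).linear_image (t • LB).toLinearMap).add hX₂c).add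
      (convex_closedBall _ _)
  have hSQ : S ⊆ P ⁻¹' Q := by
    rintro z ⟨T, hT, u, φ, hu, hsol, hφ0, rfl, huM, hφ⟩
    have hsol' : ∀ t ∈ Set.Icc (0 : ℝ) T,
        φ t = φ 0 + ∫ s in (0 : ℝ)..t, (LA (φ s) + LB (u s)) := by
      intro t ht
      simpa [hLA', hLB'] using hsol t ht
    have hCb : ∀ t ∈ Set.Icc (0 : ℝ) T, ‖LA (φ t) + LB (u t)‖ ≤ C := by
      intro t ht
      refine (norm_add_le _ _).trans (add_le_add ?_ ?_)
      · exact (LA.le_opNorm _).trans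
          (mul_le_mul_of_nonneg_left (hR' _ (interior_subset (hφ t ht))) (norm_nonneg _))
      · exact (LB.le_opNorm _).trans (mul_le_mul_of_nonneg_left (huM t ht) (norm_nonneg _))
    obtain ⟨r, hr, w, hw, hb⟩ := aux_step LA LB u hu φ T M C hT hM.le hCb hφ0 huM hsol' t ht
    have hrS : φ r ∈ S := ⟨r, hr.1, u, φ, hu, fun s hs => hsol s ⟨hs.1, hs.2.trans hr.2⟩, hφ0, rfl,
      fun s hs => huM s ⟨hs.1, hs.2.trans hr.2⟩, fun s hs => hφ s ⟨hs.1, hs.2.trans hr.2⟩⟩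
    refine Set.mem_add.2 ⟨t • LB w + φ r, Set.mem_add.2 ⟨t • LB w, ⟨w, by simpa using hw, rfl⟩,
      φ r, hSX₂ hrS, rfl⟩, _, mem_closedBall_zero_iff.2 hb, ?_⟩
    simp only [hP, ContinuousLinearMap.sub_apply, ContinuousLinearMap.id_apply,
      ContinuousLinearMap.smul_apply]
    abel
  have hX₂Q : X₂ ⊆ P ⁻¹' Q :=
    closure_minimal (convexHull_min hSQ (hQc.linear_preimage P.toLinearMap))
      (hQk.isClosed.preimage P.continuous)
  obtain ⟨z, hz, e, he, hze⟩ := Set.mem_add.1 (hX₂Q hxX₂)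
  obtain ⟨b, ⟨w, hw, rfl⟩, y, hy, rfl⟩ := Set.mem_add.1 hz
  refine ⟨w, by simpa using hw, y, hy, ?_⟩
  have : x - t • LA x - t • LB w - y = e := by
    simp only [hP, ContinuousLinearMap.sub_apply, ContinuousLinearMap.id_apply,
      ContinuousLinearMap.smul_apply] at hze
    rw [← hze]; abel
  rw [this]
  exact mem_closedBall_zero_iff.1 he
end

section
/- Consider the linear control system ẋ = Ax + Bu on ℝⁿ and n-dimensional polytopes X, X' such that 0 ∈ X° ⊂ X'°. Suppose (i) (A,B) is controllable; (ii) there exists an n-dimensional polytope X₁ with X ⊆ X₁ ⊆ X' whose strict invariance conditions are solvable, i.e., for each x ∈ ∂X₁ there exists u ∈ ℝ^m with Ax + Bu in the interior of the tangent cone to X₁ at x; and (iii) there exists an n-dimensional polytope X₂ with X ⊆ X₂ ⊆ X' whose strict backward invariance conditions are solvable, i.e., for each x ∈ ∂X₂ there exists u ∈ ℝ^m with −Ax − Bu in the interior of the tangent cone to X₂ at x. Then the system is relaxed in-block controllable (RIBC) with respect to X through X'. -/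
open Matrix Set Pointwise MeasureTheory

section Steering

set_option linter.unusedSectionVars false

open Filter Topology

variable {E F : Type*} [NormedAddCommGroup E] [NormedSpace ℝ E]
  [NormedAddCommGroup F] [NormedSpace ℝ F] [MeasurableSpace F] [BorelSpace F]
  [SecondCountableTopology F]

/-- `x` can be steered in time `T` into the set `Z`, staying in `S`, with controls bounded by `M`. -/
def Steer (a : E →L[ℝ] E) (b : F →L[ℝ] E) (T M : ℝ) (S Z : Set E) (x : E) : Prop :=
  ∃ u : ℝ → F, ∃ φ : ℝ → E, Measurable u ∧ ContinuousOn φ (Icc 0 T) ∧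
    (∃ D : Set ℝ, D.Countable ∧ ∀ t ∈ Ioo 0 T \ D, HasDerivAt φ (a (φ t) + b (u t)) t) ∧
    φ 0 = x ∧ φ T ∈ Z ∧ (∀ t ∈ Icc 0 T, ‖u t‖ ≤ M) ∧ ∀ t ∈ Icc 0 T, φ t ∈ S

variable {a : E →L[ℝ] E} {b : F →L[ℝ] E}

lemma Steer.mono {T M M' : ℝ} {S S' Z Z' : Set E} {x : E} (h : Steer a b T M S Z x)
    (hM : M ≤ M') (hS : S ⊆ S') (hZ : Z ⊆ Z') : Steer a b T M' S' Z' x := by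
  obtain ⟨u, φ, h1, h2, h3, h4, h5, h6, h7⟩ := h
  exact ⟨u, φ, h1, h2, h3, h4, hZ h5, fun t ht => (h6 t ht).trans hM, fun t ht => hS (h7 t ht)⟩

lemma Steer.convex {T M : ℝ} {S Z : Set E} (hS : Convex ℝ S) (hZ : Convex ℝ Z) :
    Convex ℝ {x | Steer a b T M S Z x} := by
  rintro x ⟨u, φ, h1, h2, ⟨D, hD, h3⟩, h4, h5, h6, h7⟩ y
    ⟨u', φ', h1', h2', ⟨D', hD', h3'⟩, h4', h5', h6', h7'⟩ p q hp hq hpq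
  refine ⟨fun t => p • u t + q • u' t, fun t => p • φ t + q • φ' t,
    (h1.const_smul p).add (h1'.const_smul q),
    (h2.const_smul p).add (h2'.const_smul q), ⟨D ∪ D', hD.union hD', ?_⟩, ?_, ?_, ?_, ?_⟩
  · rintro t ⟨ht, htD⟩
    have e1 := (h3 t ⟨ht, fun h => htD (Or.inl h)⟩).const_smul p
    have e2 := (h3' t ⟨ht, fun h => htD (Or.inr h)⟩).const_smul q
    convert! e1.add e2 using 1
    simp only [map_add, map_smul, smul_add]
    abel
  · simp [h4, h4']
  · exact hZ h5 h5' hp hq hpq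
  · intro t ht
    have e1 := h6 t ht
    have e2 := h6' t ht
    calc ‖p • u t + q • u' t‖ ≤ ‖p • u t‖ + ‖q • u' t‖ := norm_add_le _ _
      _ = p * ‖u t‖ + q * ‖u' t‖ := by
        rw [norm_smul, norm_smul, Real.norm_of_nonneg hp, Real.norm_of_nonneg hq]
      _ ≤ p * M + q * M := by gcongr
      _ = M := by rw [← add_mul, hpq, one_mul]
  · intro t ht
    exact hS (h7 t ht) (h7' t ht) hp hq hpq

lemma Steer.smul {T M c : ℝ} {S Z : Set E} {x : E} (h : Steer a b T M S Z x) (hc : 0 ≤ c)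
    (hc1 : c ≤ 1) : Steer a b T M (c • S) (c • Z) (c • x) := by
  obtain ⟨u, φ, h1, h2, ⟨D, hD, h3⟩, h4, h5, h6, h7⟩ := h
  refine ⟨fun t => c • u t, fun t => c • φ t, h1.const_smul c, h2.const_smul c,
    ⟨D, hD, ?_⟩, by simp [h4], smul_mem_smul_set h5, ?_, fun t ht => smul_mem_smul_set (h7 t ht)⟩
  · intro t ht
    convert! (h3 t ht).const_smul c using 1
    simp only [map_smul, smul_add]
  · intro t ht
    rw [norm_smul, Real.norm_of_nonneg hc]
    have := h6 t ht
    nlinarith [norm_nonneg (u t)]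

lemma Steer.trans {T T' M : ℝ} {S Z Z' : Set E} {x : E} (hT : 0 ≤ T) (hT' : 0 ≤ T')
    (h : Steer a b T M S Z x)
    (h' : ∀ y ∈ Z, Steer a b T' M S Z' y) : Steer a b (T + T') M S Z' x := by
  obtain ⟨u, φ, h1, h2, ⟨D, hD, h3⟩, h4, h5, h6, h7⟩ := h
  obtain ⟨u', φ', h1', h2', ⟨D', hD', h3'⟩, h4', h5', h6', h7'⟩ := h' _ h5
  have key : ∀ t, T ≤ t → (if t ≤ T then φ t else φ' (t - T)) = φ' (t - T) := by
    intro t ht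
    split_ifs with h
    · have : t = T := le_antisymm h ht
      subst this
      simp [h4']
    · rfl
  refine ⟨fun t => if t ≤ T then u t else u' (t - T),
    fun t => if t ≤ T then φ t else φ' (t - T), ?_, ?_,
    ⟨D ∪ {T} ∪ (fun s => s + T) '' D', (hD.union (countable_singleton T)).union (hD'.image _), ?_⟩,
    ?_, ?_, ?_, ?_⟩
  · exact Measurable.ite measurableSet_Iic h1 (h1'.comp (measurable_id.sub_const T))
  · have : Icc 0 (T + T') = Icc 0 T ∪ Icc T (T + T') :=
      (Icc_union_Icc_eq_Icc hT (by linarith)).symm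
    rw [this]
    refine ContinuousOn.union_of_isClosed ?_ ?_ isClosed_Icc isClosed_Icc
    · exact h2.congr fun t ht => if_pos ht.2
    · have : ContinuousOn (fun t => φ' (t - T)) (Icc T (T + T')) :=
        h2'.comp (by fun_prop) fun t ht => ⟨by linarith [ht.1], by linarith [ht.2]⟩
      exact this.congr fun t ht => key t ht.1
  · rintro t ⟨ht, htD⟩
    simp only [mem_union, mem_singleton_iff, not_or] at htD
    obtain ⟨⟨n1, n2⟩, n3⟩ := htD
    rcases lt_or_gt_of_ne n2 with hlt | hgt
    · have e := h3 t ⟨⟨ht.1, hlt⟩, n1⟩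
      beta_reduce
      rw [if_pos hlt.le, if_pos hlt.le]
      refine e.congr_of_eventuallyEq ?_
      filter_upwards [Iio_mem_nhds hlt] with s hs
      exact if_pos (le_of_lt hs)
    · have e := h3' (t - T) ⟨⟨by linarith, by linarith [ht.2]⟩, fun hh => n3 ⟨_, hh, by simp⟩⟩
      beta_reduce
      rw [if_neg hgt.not_ge, if_neg hgt.not_ge]
      refine (e.comp_sub_const t T).congr_of_eventuallyEq ?_
      filter_upwards [Ioi_mem_nhds hgt] with s hs
      exact if_neg (not_le.2 hs)
  · simp [hT, h4]
  · simp only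
    rw [key _ (by linarith)]
    simpa using h5'
  · intro t ht
    simp only
    split_ifs with h
    · exact h6 t ⟨ht.1, h⟩
    · exact h6' _ ⟨by linarith, by linarith [ht.2]⟩
  · intro t ht
    simp only
    split_ifs with h
    · exact h7 t ⟨ht.1, h⟩
    · exact h7' _ ⟨by linarith, by linarith [ht.2]⟩

/-- Time reversal. -/
lemma Steer.reverse {T M : ℝ} {S : Set E} {x y : E}
    (h : Steer (-a) (-b) T M S {y} x) : Steer a b T M S {x} y := by
  obtain ⟨u, φ, h1, h2, ⟨D, hD, h3⟩, h4, h5, h6, h7⟩ := h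
  have hm : ∀ t ∈ Icc 0 T, T - t ∈ Icc 0 T := fun t ht => ⟨by linarith [ht.2], by linarith [ht.1]⟩
  refine ⟨fun t => u (T - t), fun t => φ (T - t), h1.comp (by fun_prop),
    h2.comp (by fun_prop) hm, ⟨(fun s => T - s) '' D, hD.image _, ?_⟩, ?_, ?_,
    fun t ht => h6 _ (hm t ht), fun t ht => h7 _ (hm t ht)⟩
  · rintro t ⟨ht, htD⟩
    have e := h3 (T - t) ⟨⟨by linarith [ht.2], by linarith [ht.1]⟩, fun hh => htD ⟨_, hh, by simp⟩⟩
    convert! e.comp_const_sub T t using 1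
    simp
    abel
  · simpa using h5
  · simp [h4]

lemma Steer.exists_end {T M : ℝ} {S Z : Set E} {x : E} (h : Steer a b T M S Z x) :
    ∃ z ∈ Z, Steer a b T M S {z} x := by
  obtain ⟨u, φ, h1, h2, h3, h4, h5, h6, h7⟩ := h
  exact ⟨φ T, h5, u, φ, h1, h2, h3, h4, rfl, h6, h7⟩

/-- Abstract version of "`w` is in the interior of the tangent cone to `S` at `v`". -/
def Inward (S : Set E) (v w : E) : Prop :=
  ∃ δ > (0 : ℝ), ∀ ε > (0 : ℝ), ∃ t₀ > (0 : ℝ), ∃ s₀ ∈ S, ‖v + t₀ • (w + δ • v) - s₀‖ ≤ ε * t₀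

lemma Inward.eventually_mem {S : Set E} (hS : Convex ℝ S) (h0 : (0 : E) ∈ interior S) {v w : E}
    (hv : v ∈ S) (h : Inward S v w) {φ : ℝ → E} (hφ0 : φ 0 = v) (hφ : HasDerivAt φ w 0) :
    ∀ᶠ t in 𝓝[>] (0 : ℝ), φ t ∈ interior S := by
  obtain ⟨δ, hδ, h⟩ := h
  obtain ⟨r, hr, hball⟩ := Metric.isOpen_iff.1 isOpen_interior 0 h0
  obtain ⟨t₀, ht₀, s₀, hs₀, hs⟩ := h (r * δ / 4) (by positivity)
  have hd : ∃ d : E, t₀ • d = s₀ - v := ⟨t₀⁻¹ • (s₀ - v), smul_inv_smul₀ ht₀.ne' _⟩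
  obtain ⟨d, hd⟩ := hd
  have hwd : ‖w + δ • v - d‖ ≤ r * δ / 4 := by
    have e : v + t₀ • (w + δ • v) - s₀ = t₀ • (w + δ • v - d) := by
      rw [smul_sub t₀ _ d, hd]; abel
    rw [e, norm_smul, Real.norm_of_nonneg ht₀.le] at hs
    nlinarith
  have hlit := (hasDerivAt_iff_isLittleO.1 hφ).def (show 0 < r * δ / 4 by positivity)
  have e1 : ∀ᶠ t in 𝓝[>] (0 : ℝ), t < t₀ :=
    nhdsWithin_le_nhds (Iio_mem_nhds ht₀)
  have e2 : ∀ᶠ t in 𝓝[>] (0 : ℝ), t < 1 / δ :=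
    nhdsWithin_le_nhds (Iio_mem_nhds (by positivity))
  have e3 : ∀ᶠ t in 𝓝[>] (0 : ℝ), t < (r / 4) / (‖d‖ + 1) :=
    nhdsWithin_le_nhds (Iio_mem_nhds (by positivity))
  filter_upwards [e1, e2, e3, nhdsWithin_le_nhds hlit, self_mem_nhdsWithin] with t h1 h2 h3 h4 h5
  have h5 : 0 < t := h5
  simp only [sub_zero, hφ0, Real.norm_of_nonneg h5.le] at h4
  rw [lt_div_iff₀ hδ] at h2
  rw [lt_div_iff₀ (by positivity)] at h3
  have hmem : v + t • d ∈ S := by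
    have : v + t • d = (1 - t / t₀) • v + (t / t₀) • s₀ := by
      have : s₀ = v + t₀ • d := by rw [hd]; abel
      rw [this, smul_add, smul_smul, div_mul_cancel₀ _ ht₀.ne', sub_smul, one_smul]
      abel
    rw [this]
    have : t / t₀ ≤ 1 := (div_le_one ht₀).2 h1.le
    exact hS hv hs₀ (by linarith) (by positivity) (by ring)
  have htd : 0 < t * δ := by positivity
  obtain ⟨q, hq⟩ : ∃ q : E, (t * δ) • q = φ t - (1 - t * δ) • (v + t • d) :=
    ⟨(t * δ)⁻¹ • (φ t - (1 - t * δ) • (v + t • d)), smul_inv_smul₀ htd.ne' _⟩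
  have hqn : ‖q‖ < r := by
    have e : (t * δ) • q = (φ t - v - t • w) + t • (w + δ • v - d) + (t * δ) • t • d := by
      rw [hq]; module
    have : ‖(t * δ) • q‖ ≤ (r * δ / 4) * t + t * (r * δ / 4) + (t * δ) * (t * ‖d‖) := by
      rw [e]
      refine (norm_add₃_le).trans ?_
      rw [norm_smul t, norm_smul (t * δ), norm_smul t, Real.norm_of_nonneg h5.le,
        Real.norm_of_nonneg htd.le]
      gcongr
    rw [norm_smul, Real.norm_of_nonneg htd.le] at this
    have h6 : t * ‖d‖ < r / 4 := by nlinarith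
    have : (t * δ) * ‖q‖ < (t * δ) * r := by nlinarith [mul_pos htd hr]
    exact lt_of_mul_lt_mul_left this htd.le
  have : φ t = (t * δ) • q + (1 - t * δ) • (v + t • d) := by rw [hq]; abel
  rw [this]
  exact hS.combo_interior_self_mem_interior (hball (by simpa using hqn)) hmem htd (by linarith)
    (by ring)

lemma local_step [CompleteSpace E] {S : Set E} (hS : Convex ℝ S) (h0 : (0 : E) ∈ interior S)
    {v : E} (hv : v ∈ S) (h : v ∈ interior S ∨ ∃ u, Inward S v (a v + b u)) :
    ∃ M : ℝ, ∀ᶠ T in 𝓝[>] (0 : ℝ), Steer a b T M S (interior S) v := by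
  have sol : ∀ u : F, ∃ φ : ℝ → E, φ 0 = v ∧ ∃ ε > (0 : ℝ),
      ∀ t ∈ Ioo (0 - ε) (0 + ε), HasDerivAt φ (a (φ t) + b u) t := fun u =>
    ContDiffAt.exists_forall_mem_closedBall_exists_eq_forall_mem_Ioo_hasDerivAt₀
      (f := fun y => a y + b u) (x₀ := v) (by fun_prop) 0
  have key : ∃ u : F, ∃ φ : ℝ → E, φ 0 = v ∧ (∃ ε > (0 : ℝ),
      ∀ t ∈ Ioo (0 - ε) (0 + ε), HasDerivAt φ (a (φ t) + b u) t) ∧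
      ∀ᶠ t in 𝓝[>] (0 : ℝ), φ t ∈ interior S := by
    rcases h with h | ⟨u, h⟩
    · obtain ⟨φ, hφ, ε, hε, hd⟩ := sol 0
      refine ⟨0, φ, hφ, ⟨ε, hε, hd⟩, ?_⟩
      have hc := (hd 0 ⟨by linarith, by linarith⟩).continuousAt
      exact nhdsWithin_le_nhds (hc.eventually (isOpen_interior.mem_nhds (by rwa [hφ])))
    · obtain ⟨φ, hφ, ε, hε, hd⟩ := sol u
      refine ⟨u, φ, hφ, ⟨ε, hε, hd⟩, ?_⟩
      refine h.eventually_mem hS h0 hv hφ ?_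
      have := hd 0 ⟨by linarith, by linarith⟩
      rwa [hφ] at this
  obtain ⟨u, φ, hφ, ⟨ε, hε, hd⟩, hev⟩ := key
  refine ⟨‖u‖, ?_⟩
  obtain ⟨η, hη, hηS⟩ := (mem_nhdsGT_iff_exists_Ioo_subset).1 hev
  have hη : 0 < η := hη
  filter_upwards [Ioo_mem_nhdsGT (lt_min hε hη)] with T hT
  have hT1 := hT.2.trans_le (min_le_left _ _)
  have hT2 := hT.2.trans_le (min_le_right _ _)
  refine ⟨fun _ => u, φ, measurable_const, ?_, ⟨∅, countable_empty, ?_⟩, hφ, hηS ⟨hT.1, hT2⟩,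
    fun _ _ => le_rfl, ?_⟩
  · intro t ht
    exact (hd t ⟨by linarith [ht.1], by linarith [ht.2]⟩).continuousAt.continuousWithinAt
  · rintro t ⟨ht, -⟩
    exact hd t ⟨by linarith [ht.1], by linarith [ht.2]⟩
  · intro t ht
    rcases ht.1.eq_or_lt with h | h
    · rw [← h, hφ]; exact hv
    · exact interior_subset (hηS ⟨h, ht.2.trans_lt hT2⟩)

lemma smul_subset_of_le {S : Set E} (hS : Convex ℝ S) (h0 : (0 : E) ∈ S) {c : ℝ}
    (hc : 0 ≤ c) (hc1 : c ≤ 1) : c • S ⊆ S := by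
  rintro _ ⟨x, hx, rfl⟩
  exact hS.smul_mem_of_zero_mem h0 hx ⟨hc, hc1⟩

lemma smul_subset_interior {S : Set E} (hS : Convex ℝ S) (h0 : (0 : E) ∈ interior S) {c : ℝ}
    (hc : 0 ≤ c) (hc1 : c < 1) : c • S ⊆ interior S := by
  rintro _ ⟨x, hx, rfl⟩
  have := hS.combo_interior_self_mem_interior h0 hx (a := 1 - c) (b := c) (by linarith) hc (by ring)
  simpa using this

lemma eventually_mem_smul {S : Set E} {z : E} (hz : z ∈ interior S) :
    ∀ᶠ ρ in 𝓝[<] (1 : ℝ), z ∈ ρ • S := by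
  have hc : ContinuousAt (fun ρ : ℝ => ρ⁻¹ • z) 1 :=
    (continuousAt_inv₀ one_ne_zero).smul continuousAt_const
  have h1 := hc.eventually (isOpen_interior.mem_nhds (by simpa using hz))
  filter_upwards [nhdsWithin_le_nhds h1,
    nhdsWithin_le_nhds (Ioi_mem_nhds (show (0 : ℝ) < 1 by norm_num))] with ρ h2 h3
  exact (mem_smul_set_iff_inv_smul_mem₀ (ne_of_gt h3) _ _).2 (interior_subset h2)

lemma uniform_step [CompleteSpace E] (V : Finset E) {S : Set E} (hSV : S = convexHull ℝ (V : Set E))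
    (h0 : (0 : E) ∈ interior S)
    (h : ∀ v ∈ S, v ∈ interior S ∨ ∃ u, Inward S v (a v + b u)) :
    ∃ T > 0, ∃ M : ℝ, ∃ ρ ∈ Ioo (0 : ℝ) 1, ∀ x ∈ S, Steer a b T M S (ρ • S) x := by
  have hS : Convex ℝ S := hSV ▸ convex_convexHull ℝ _
  have hVS : ∀ v ∈ V, v ∈ S := fun v hv => hSV ▸ subset_convexHull ℝ _ hv
  have h1 : ∀ v : V, ∃ M : ℝ, ∀ᶠ T in 𝓝[>] (0 : ℝ), Steer a b T M S (interior S) v :=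
    fun v => local_step hS h0 (hVS v v.2) (h v (hVS v v.2))
  choose M hM using h1
  obtain ⟨T, hT, hT0⟩ := ((eventually_all.2 hM).and self_mem_nhdsWithin).exists
  have hT0 : 0 < T := hT0
  choose z hz hz' using fun v => (hT v).exists_end
  obtain ⟨M', hM'⟩ := (eventually_all.2 fun v => eventually_ge_atTop (M v)).exists
  obtain ⟨ρ, hρ, hρ1⟩ := ((eventually_all.2 fun v => eventually_mem_smul (hz v)).and
    (Ioo_mem_nhdsLT (show (0 : ℝ) < 1 by norm_num))).exists
  refine ⟨T, hT0, M', ρ, hρ1, ?_⟩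
  have : S ⊆ {x | Steer a b T M' S (ρ • S) x} := by
    conv_lhs => rw [hSV]
    refine convexHull_min ?_ (Steer.convex hS (hS.smul ρ))
    intro v hv
    exact (hz' ⟨v, hv⟩).mono (hM' ⟨v, hv⟩) subset_rfl (by simpa using hρ ⟨v, hv⟩)
  exact this

lemma iterate_step {S : Set E} (hS : Convex ℝ S) (h0 : (0 : E) ∈ S) {T M ρ : ℝ} (hT : 0 < T)
    (hρ : ρ ∈ Ioo (0 : ℝ) 1) (h : ∀ x ∈ S, Steer a b T M S (ρ • S) x) (N : ℕ) :
    ∀ x ∈ S, Steer a b ((N + 1 : ℕ) * T) M S (ρ ^ (N + 1) • S) x := by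
  induction N with
  | zero => simpa using h
  | succ N ih =>
    intro x hx
    have := (ih x hx).trans (T' := T) (Z' := ρ ^ (N + 1 + 1) • S) (by positivity) hT.le ?_
    · convert! this using 1
      push_cast; ring
    · rintro _ ⟨y, hy, rfl⟩
      have hp := pow_nonneg hρ.1.le (N + 1)
      have hp1 := pow_le_one₀ hρ.1.le hρ.2.le (n := N + 1)
      refine ((h y hy).smul hp hp1).mono le_rfl (smul_subset_of_le hS h0 hp hp1) ?_
      rw [smul_smul, ← pow_succ]

lemma steer_to_zero [CompleteSpace E] (V : Finset E) {S : Set E}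
    (hSV : S = convexHull ℝ (V : Set E))
    (h0 : (0 : E) ∈ interior S)
    (h : ∀ v ∈ S, v ∈ interior S ∨ ∃ u, Inward S v (a v + b u))
    (hK : ∀ x : E, ∃ R, Steer a b 1 R (Metric.closedBall 0 R) {0} x) :
    ∃ T ≥ 0, ∃ M : ℝ, ∀ x ∈ interior S, Steer a b T M (interior S) {0} x := by
  have hS : Convex ℝ S := hSV ▸ convex_convexHull ℝ _
  have h0S : (0 : E) ∈ S := interior_subset h0
  obtain ⟨T, hT, M, ρ, hρ, hstep⟩ := uniform_step V hSV h0 h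
  choose R hR using hK
  obtain ⟨R', hR', hR0⟩ := ((eventually_all.2 fun v : V => eventually_ge_atTop (R v)).and
    (eventually_ge_atTop 0)).exists
  have hk : ∀ x ∈ S, Steer a b 1 R' (Metric.closedBall 0 R') {0} x := by
    have : S ⊆ {x | Steer a b 1 R' (Metric.closedBall 0 R') {0} x} := by
      rw [hSV]
      refine convexHull_min ?_ (Steer.convex (convex_closedBall _ _) (convex_singleton _))
      intro v hv
      exact (hR v).mono (hR' ⟨v, hv⟩) (Metric.closedBall_subset_closedBall (hR' ⟨v, hv⟩)) subset_rfl
    exact this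
  obtain ⟨r, hr, hball⟩ := Metric.isOpen_iff.1 isOpen_interior 0 h0
  obtain ⟨N, hN⟩ := exists_pow_lt_of_lt_one (show 0 < r / (R' + r) by positivity) hρ.2
  set c := ρ ^ (N + 1) with hc
  have hc0 : 0 < c := pow_pos hρ.1 _
  have hc1 : c ≤ 1 := pow_le_one₀ hρ.1.le hρ.2.le
  have hcr : c * R' < r := by
    have : c < r / (R' + r) := lt_of_le_of_lt
      (pow_le_pow_of_le_one hρ.1.le hρ.2.le (Nat.le_succ N)) hN
    rw [lt_div_iff₀ (by positivity)] at this
    nlinarith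
  have hfin : ∀ y ∈ c • S, Steer a b 1 (max M R') S {0} y := by
    rintro _ ⟨y, hy, rfl⟩
    refine ((hk y hy).smul hc0.le hc1).mono (le_max_right _ _) ?_ (by simp)
    rintro _ ⟨w, hw, rfl⟩
    apply interior_subset (hball _)
    simp only [mem_closedBall_zero_iff] at hw
    simp only [mem_ball_zero_iff, norm_smul, Real.norm_of_nonneg hc0.le]
    nlinarith
  have hall : ∀ x ∈ S, Steer a b ((N + 1 : ℕ) * T + 1) (max M R') S {0} x := fun x hx =>
    Steer.trans (by positivity) zero_le_one
      ((iterate_step hS h0S hT hρ hstep N x hx).mono (le_max_left _ _) subset_rfl subset_rfl) hfin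
  refine ⟨(N + 1 : ℕ) * T + 1, by positivity, max M R', fun x hx => ?_⟩
  obtain ⟨d, hd, hd1⟩ := ((eventually_mem_smul hx).and
    (Ioo_mem_nhdsLT (show (0 : ℝ) < 1 by norm_num))).exists
  obtain ⟨y, hy, rfl⟩ := hd
  exact ((hall y hy).smul hd1.1.le hd1.2.le).mono le_rfl (smul_subset_interior hS h0 hd1.1.le hd1.2)
    (by simp)

/-- Smooth functions vanishing near `0` and near `1`. -/
def Flat {G : Type*} [NormedAddCommGroup G] [NormedSpace ℝ G] (f : ℝ → G) : Prop :=
  ContDiff ℝ (⊤ : ℕ∞) f ∧ f =ᶠ[𝓝 0] 0 ∧ f =ᶠ[𝓝 1] 0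

lemma Flat.deriv {G : Type*} [NormedAddCommGroup G] [NormedSpace ℝ G] {f : ℝ → G}
    (h : Flat f) : Flat (deriv f) := by
  refine ⟨(contDiff_infty_iff_deriv.1 h.1).2, ?_, ?_⟩
  · refine h.2.1.deriv.trans ?_
    rw [show (0 : ℝ → G) = fun _ => 0 from rfl]
    simp
  · refine h.2.2.deriv.trans ?_
    rw [show (0 : ℝ → G) = fun _ => 0 from rfl]
    simp

lemma Flat.clm {G G' : Type*} [NormedAddCommGroup G] [NormedSpace ℝ G]
    [NormedAddCommGroup G'] [NormedSpace ℝ G'] {f : ℝ → G}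
    (h : Flat f) (L : G →L[ℝ] G') : Flat (fun t => L (f t)) := by
  refine ⟨L.contDiff.comp h.1, ?_, ?_⟩
  · filter_upwards [h.2.1] with t ht
    simp [ht]
  · filter_upwards [h.2.2] with t ht
    simp [ht]

/-- Chain-of-integrators step: absorbing a disturbance entering through `A^k B`. -/
lemma absorb (a : E →L[ℝ] E) (b : F →L[ℝ] E) (k : ℕ) : ∀ f : ℝ → F, Flat f →
    ∃ z : ℝ → E, ∃ u : ℝ → F, Continuous u ∧ z 0 = 0 ∧ z 1 = 0 ∧
      ∀ t, HasDerivAt z (a (z t) + b (u t) - (a ^ k) (b (f t))) t := by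
  induction k with
  | zero =>
    intro f hf
    refine ⟨0, f, hf.1.continuous, rfl, rfl, fun t => ?_⟩
    simpa using hasDerivAt_const t (0 : E)
  | succ k ih =>
    intro f hf
    obtain ⟨z, u, hu, hz0, hz1, hz⟩ := ih _ hf.deriv
    have hfd : ∀ t, HasDerivAt f (_root_.deriv f t) t := fun t =>
      ((hf.1.differentiable (by simp)) t).hasDerivAt
    refine ⟨fun t => (a ^ k) (b (f t)) + z t, u, hu, ?_, ?_, fun t => ?_⟩
    · simp [hz0, hf.2.1.self_of_nhds]
    · simp [hz1, hf.2.2.self_of_nhds]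
    · have e := (((a ^ k).comp b).hasFDerivAt.comp_hasDerivAt t (hfd t)).add (hz t)
      convert! e using 1
      simp [pow_succ']
      abel

lemma kalman [CompleteSpace E] (a : E →L[ℝ] E) (b : F →L[ℝ] E) (n : ℕ) (N : Fin n → E →L[ℝ] F)
    (hN : ∀ x, ∑ k : Fin n, (a ^ (k : ℕ)) (b (N k x)) = x) (x : E) :
    ∃ R, Steer a b 1 R (Metric.closedBall 0 R) {0} x := by
  set e : ℝ → E := fun t => NormedSpace.exp (t • a) x with he
  have hed : ∀ t, HasDerivAt e (a (e t)) t := fun t => by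
    have h1 := hasDerivAt_exp_smul_const' (𝕂 := ℝ) a t
    have h2 := h1.clm_apply (hasDerivAt_const t x)
    simpa using h2
  have hes : ContDiff ℝ (⊤ : ℕ∞) e := by
    rw [contDiff_infty]
    intro k
    induction k with
    | zero =>
      rw [Nat.cast_zero, contDiff_zero]
      exact continuous_iff_continuousAt.2 fun t => (hed t).continuousAt
    | succ k ih =>
      rw [Nat.cast_succ, contDiff_succ_iff_deriv]
      refine ⟨fun t => (hed t).differentiableAt, by simp, ?_⟩
      have : deriv e = fun t => a (e t) := funext fun t => (hed t).deriv
      rw [this]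
      exact a.contDiff.comp ih
  set α : ℝ → ℝ := fun t => 1 - Real.smoothTransition (3 * t - 1) with hα
  have hαs : ContDiff ℝ (⊤ : ℕ∞) α :=
    contDiff_const.sub (Real.smoothTransition.contDiff.comp (by fun_prop))
  have hα0 : α =ᶠ[𝓝 0] fun _ => 1 := by
    filter_upwards [Iio_mem_nhds (show (0 : ℝ) < 1 / 3 by norm_num)] with t ht
    have ht : t < 1 / 3 := ht
    simp only [hα]
    rw [Real.smoothTransition.zero_of_nonpos (by linarith), sub_zero]
  have hα1 : α =ᶠ[𝓝 1] fun _ => 0 := by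
    filter_upwards [Ioi_mem_nhds (show (2 / 3 : ℝ) < 1 by norm_num)] with t ht
    have ht : 2 / 3 < t := ht
    simp only [hα]
    rw [Real.smoothTransition.one_of_one_le (by linarith), sub_self]
  have hαd : ∀ t, HasDerivAt α (deriv α t) t := fun t =>
    ((hαs.differentiable (by simp)) t).hasDerivAt
  have hg : Flat (fun t => deriv α t • e t) := by
    refine ⟨(contDiff_infty_iff_deriv.1 hαs).2.smul hes, ?_, ?_⟩
    · filter_upwards [hα0.deriv] with t ht
      simp [ht]
    · filter_upwards [hα1.deriv] with t ht
      simp [ht]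
  choose z u hu hz0 hz1 hz using fun k : Fin n => absorb a b k _ (hg.clm (N k))
  have hφ : ∀ t, HasDerivAt (fun t => α t • e t + ∑ k, z k t)
      (a (α t • e t + ∑ k, z k t) + b (∑ k, u k t)) t := fun t => by
    have h1 := (hαd t).fun_smul (hed t)
    have h2 := HasDerivAt.fun_sum (u := Finset.univ) fun k (_ : k ∈ Finset.univ) => hz k t
    convert! h1.add h2 using 1
    rw [Finset.sum_sub_distrib, hN, Finset.sum_add_distrib]
    simp only [map_add, map_sum, map_smul]
    abel
  have hφc : Continuous (fun t => α t • e t + ∑ k, z k t) :=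
    continuous_iff_continuousAt.2 fun t => (hφ t).continuousAt
  have huc : Continuous (fun t => ∑ k, u k t) := continuous_finsetSum _ fun k _ => hu k
  obtain ⟨R1, hR1⟩ := (isCompact_Icc (a := (0 : ℝ)) (b := 1)).exists_bound_of_continuousOn
    hφc.continuousOn
  obtain ⟨R2, hR2⟩ := (isCompact_Icc (a := (0 : ℝ)) (b := 1)).exists_bound_of_continuousOn
    huc.continuousOn
  refine ⟨max R1 R2, _, _, huc.measurable, hφc.continuousOn,
    ⟨∅, countable_empty, fun t _ => hφ t⟩, ?_, ?_, fun t ht => (hR2 t ht).trans (le_max_right _ _),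
    fun t ht => mem_closedBall_zero_iff.2 ((hR1 t ht).trans (le_max_left _ _))⟩
  · simp [hz0, hα0.self_of_nhds, he]
  · simp [hz1, hα1.self_of_nhds]

end Steering

open Filter Topology in
lemma inward_of_bouligand {n : ℕ} {S : Set (Fin n → ℝ)} {v w : Fin n → ℝ} (hv : v ∈ S)
    (h : w ∈ interior (bouligand S v)) : Inward S v w := by
  have hc : ContinuousAt (fun δ : ℝ => w + δ • v) 0 := by fun_prop
  have h1 := hc.eventually (isOpen_interior.mem_nhds (by simpa using h))
  obtain ⟨δ, hδ, hδ0⟩ := ((h1.filter_mono nhdsWithin_le_nhds).and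
    (self_mem_nhdsWithin : ∀ᶠ t in 𝓝[>] (0 : ℝ), t ∈ Ioi 0)).exists
  refine ⟨δ, hδ0, fun ε hε => ?_⟩
  have hb : Filter.liminf (fun t : ℝ => Metric.infDist (v + t • (w + δ • v)) S / t)
        (nhdsWithin 0 (Set.Ioi 0)) = 0 :=
    (interior_subset (s := bouligand S v) hδ : w + δ • v ∈ bouligand S v)
  have hbd : ∀ᶠ t in 𝓝[>] (0 : ℝ),
      Metric.infDist (v + t • (w + δ • v)) S / t ≤ ‖w + δ • v‖ := by
    filter_upwards [self_mem_nhdsWithin] with t ht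
    have ht : 0 < t := ht
    rw [div_le_iff₀ ht]
    refine (Metric.infDist_le_dist_of_mem hv).trans ?_
    rw [dist_eq_norm, add_sub_cancel_left, norm_smul, Real.norm_of_nonneg ht.le, mul_comm]
  have hcob : IsCoboundedUnder (· ≥ ·) (𝓝[>] (0 : ℝ))
      (fun t : ℝ => Metric.infDist (v + t • (w + δ • v)) S / t) :=
    IsBoundedUnder.isCoboundedUnder_ge ⟨_, hbd⟩
  have hf := frequently_lt_of_liminf_lt hcob (hb.trans_lt hε)
  obtain ⟨t, ht, ht0⟩ := (hf.and_eventually self_mem_nhdsWithin).exists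
  have ht0 : 0 < t := ht0
  rw [div_lt_iff₀ ht0] at ht
  obtain ⟨s, hs, hst⟩ := (Metric.infDist_lt_iff ⟨v, hv⟩).1 ht
  exact ⟨t, ht0, s, hs, by rw [← dist_eq_norm]; exact hst.le⟩

/-- A matrix as a continuous linear map. -/
noncomputable def mclm {n m : ℕ} (A : Matrix (Fin n) (Fin m) ℝ) : (Fin m → ℝ) →L[ℝ] (Fin n → ℝ) :=
  A.mulVecLin.toContinuousLinearMap

lemma mclm_apply {n m : ℕ} (A : Matrix (Fin n) (Fin m) ℝ) (x : Fin m → ℝ) :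
    mclm A x = A.mulVec x := rfl

lemma mclm_pow {n : ℕ} (A : Matrix (Fin n) (Fin n) ℝ) (k : ℕ) (x : Fin n → ℝ) :
    (mclm A ^ k) x = (A ^ k).mulVec x := by
  induction k generalizing x with
  | zero => simp
  | succ k ih => rw [pow_succ, mul_apply_eq_comp, ih, mclm_apply, pow_succ,
      Matrix.mulVec_mulVec]

lemma exists_right_inverse {n m : ℕ} {A : Matrix (Fin n) (Fin n) ℝ} {B : Matrix (Fin n) (Fin m) ℝ}
    (h : Controllable A B) : ∃ N : Fin n → (Fin n → ℝ) →L[ℝ] (Fin m → ℝ),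
      ∀ x, ∑ k : Fin n, (mclm A ^ (k : ℕ)) (mclm B (N k x)) = x := by
  have hs : Function.Surjective (ctrbMat A B).mulVec := by
    have : LinearMap.range (ctrbMat A B).mulVecLin = ⊤ := by
      apply Submodule.eq_top_of_finrank_eq
      rw [Module.finrank_fin_fun]
      exact h
    exact LinearMap.range_eq_top.1 this
  obtain ⟨C, hC⟩ := Matrix.mulVec_surjective_iff_exists_right_inverse.1 hs
  refine ⟨fun k => mclm (Matrix.of fun j i => C (k, j) i), fun x => ?_⟩
  have : x = (ctrbMat A B).mulVec (C.mulVec x) := by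
    rw [Matrix.mulVec_mulVec, hC, Matrix.one_mulVec]
  conv_rhs => rw [this]
  ext i
  have e : ∀ k : Fin n, (mclm A ^ (k : ℕ)) (mclm B (mclm (Matrix.of fun j i => C (k, j) i) x)) =
      (A ^ (k : ℕ) * B).mulVec ((Matrix.of fun j i => C (k, j) i).mulVec x) := fun k => by
    rw [mclm_pow, mclm_apply, mclm_apply, Matrix.mulVec_mulVec]
  simp only [e, Finset.sum_apply]
  simp only [Matrix.mulVec, dotProduct, Fintype.sum_prod_type, ctrbMat, Matrix.of_apply]

lemma neg_right_inverse {n m : ℕ} {a : (Fin n → ℝ) →L[ℝ] (Fin n → ℝ)}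
    {b : (Fin m → ℝ) →L[ℝ] (Fin n → ℝ)}
    (h : ∃ N : Fin n → (Fin n → ℝ) →L[ℝ] (Fin m → ℝ),
      ∀ x, ∑ k : Fin n, (a ^ (k : ℕ)) (b (N k x)) = x) :
    ∃ N : Fin n → (Fin n → ℝ) →L[ℝ] (Fin m → ℝ),
      ∀ x, ∑ k : Fin n, ((-a) ^ (k : ℕ)) ((-b) (N k x)) = x := by
  obtain ⟨N, hN⟩ := h
  refine ⟨fun k => (-1 : ℝ) ^ ((k : ℕ) + 1) • N k, fun x => ?_⟩
  conv_rhs => rw [← hN x]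
  refine Finset.sum_congr rfl fun k _ => ?_
  have hp : ∀ (k : ℕ) (y : Fin n → ℝ), ((-a) ^ k) y = (-1 : ℝ) ^ k • (a ^ k) y := by
    intro k
    induction k with
    | zero => intro y; simp
    | succ k ih =>
      intro y
      rw [pow_succ, mul_apply_eq_comp, ih, pow_succ a, mul_apply_eq_comp,
        _root_.neg_apply, map_neg, pow_succ]
      simp only [mul_neg, mul_one, neg_smul, smul_neg]
  rw [hp, _root_.neg_apply, map_neg, _root_.smul_apply, map_smul,
    map_smul, ← smul_neg, smul_comm, smul_smul]
  have h1 : (-1 : ℝ) ^ ((k : ℕ) + 1) * (-1 : ℝ) ^ (k : ℕ) = -1 := by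
    rw [pow_succ, mul_right_comm, ← mul_pow]
    simp
  rw [h1, neg_one_smul, neg_neg]

lemma Steer.to_sol {n m : ℕ} {A : Matrix (Fin n) (Fin n) ℝ} {B : Matrix (Fin n) (Fin m) ℝ}
    {T M : ℝ} {S : Set (Fin n → ℝ)} {x y : Fin n → ℝ}
    (h : Steer (mclm A) (mclm B) T M S {y} x) :
    ∃ u : ℝ → Fin m → ℝ, ∃ φ : ℝ → Fin n → ℝ,
      Measurable u ∧ IsSol A B 0 u φ T ∧ φ 0 = x ∧ φ T = y ∧
      (∀ t ∈ Set.Icc (0 : ℝ) T, ‖u t‖ ≤ M) ∧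
      (∀ t ∈ Set.Icc (0 : ℝ) T, φ t ∈ S) := by
  obtain ⟨u, φ, h1, h2, ⟨D, hD, h3⟩, h4, h5, h6, h7⟩ := h
  refine ⟨u, φ, h1, fun t ht => ?_, h4, h5, h6, h7⟩
  have hsub : Icc 0 t ⊆ Icc 0 T := Icc_subset_Icc_right ht.2
  have hi1 : IntervalIntegrable (fun s => mclm A (φ s)) volume 0 t :=
    ContinuousOn.intervalIntegrable (by
      rw [uIcc_of_le ht.1]
      exact (mclm A).continuous.comp_continuousOn (h2.mono hsub))
  have hi2 : IntervalIntegrable (fun s => mclm B (u s)) volume 0 t := by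
    rw [intervalIntegrable_iff_integrableOn_Ioc_of_le ht.1]
    refine Measure.integrableOn_of_bounded (M := ‖mclm B‖ * M) (by simp)
      ((mclm B).continuous.measurable.comp h1).aestronglyMeasurable ?_
    refine (ae_restrict_iff' measurableSet_Ioc).2 (Filter.Eventually.of_forall fun s hs => ?_)
    refine ((mclm B).le_opNorm _).trans ?_
    have := h6 s (hsub ⟨hs.1.le, hs.2⟩)
    gcongr
  have := integral_eq_of_hasDerivAt_off_countable_of_le φ (fun s => mclm A (φ s) + mclm B (u s))
    ht.1 hD (h2.mono hsub) (fun s hs => h3 s ⟨⟨hs.1.1, hs.1.2.trans_le ht.2⟩, hs.2⟩) (hi1.add hi2)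
  simp only [mclm_apply] at this
  simp only [add_zero, this]
  abel

/-- sufficiency. If `(A,B)` is controllable and there are `n`-dimensional
polytopes `X₁, X₂` with `X ⊆ X₁ ⊆ X'`, `X ⊆ X₂ ⊆ X'` satisfying the strict (forward resp.
backward) invariance conditions — the vector field can be put in the *interior* of the tangent
cone at each boundary point — then the linear system is RIBC w.r.t. `X` through `X'`. -/
theorem stmt7 {n m : ℕ} (A : Matrix (Fin n) (Fin n) ℝ) (B : Matrix (Fin n) (Fin m) ℝ)
    (hB : B.rank = m) (X X' : Set (Fin n → ℝ))
    (hX : IsNPolytope X) (hX' : IsNPolytope X')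
    (h0 : (0 : Fin n → ℝ) ∈ interior X) (hXX' : interior X ⊂ interior X')
    (hctrb : Controllable A B)
    (X₁ : Set (Fin n → ℝ)) (hX₁ : IsNPolytope X₁) (hXX₁ : X ⊆ X₁) (hX₁X' : X₁ ⊆ X')
    (hinv : ∀ x ∈ frontier X₁, ∃ u : Fin m → ℝ,
      A.mulVec x + B.mulVec u ∈ interior (bouligand X₁ x))
    (X₂ : Set (Fin n → ℝ)) (hX₂ : IsNPolytope X₂) (hXX₂ : X ⊆ X₂) (hX₂X' : X₂ ⊆ X')
    (hbinv : ∀ x ∈ frontier X₂, ∃ u : Fin m → ℝ,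
      -(A.mulVec x) - B.mulVec u ∈ interior (bouligand X₂ x)) :
    RIBC A B 0 X X' := by
  have hN := exists_right_inverse hctrb
  obtain ⟨N, hN1⟩ := hN
  obtain ⟨N', hN2⟩ := neg_right_inverse ⟨N, hN1⟩
  have h01 : (0 : Fin n → ℝ) ∈ interior X₁ := interior_mono hXX₁ h0
  have h02 : (0 : Fin n → ℝ) ∈ interior X₂ := interior_mono hXX₂ h0
  have hsplit : ∀ S : Set (Fin n → ℝ), ∀ v ∈ S, v ∈ interior S ∨ v ∈ frontier S := by
    intro S v hv
    by_cases h : v ∈ interior S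
    · exact Or.inl h
    · exact Or.inr ⟨subset_closure hv, h⟩
  obtain ⟨V₁, hV₁⟩ := hX₁.1
  obtain ⟨V₂, hV₂⟩ := hX₂.1
  obtain ⟨T₁, hT₁, M₁, hM₁⟩ := steer_to_zero (a := mclm A) (b := mclm B) V₁ hV₁ h01
    (fun v hv => (hsplit X₁ v hv).imp id fun hf => by
      obtain ⟨u, hu⟩ := hinv v hf
      exact ⟨u, inward_of_bouligand hv hu⟩)
    (kalman _ _ n N hN1)
  obtain ⟨T₂, hT₂, M₂, hM₂⟩ := steer_to_zero (a := -mclm A) (b := -mclm B) V₂ hV₂ h02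
    (fun v hv => (hsplit X₂ v hv).imp id fun hf => by
      obtain ⟨u, hu⟩ := hbinv v hf
      rw [sub_eq_add_neg] at hu
      exact ⟨u, inward_of_bouligand hv hu⟩)
    (kalman _ _ n N' hN2)
  refine ⟨max 1 (max M₁ M₂), by positivity, fun x hx y hy => ⟨T₁ + T₂, by positivity, ?_⟩⟩
  have s1 := (hM₁ x (interior_mono hXX₁ hx)).mono (M' := max 1 (max M₁ M₂)) (S' := interior X')
    (by simp) (interior_mono hX₁X') subset_rfl
  have s2 := (hM₂ y (interior_mono hXX₂ hy)).reverse.mono (M' := max 1 (max M₁ M₂))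
    (S' := interior X') (by simp) (interior_mono hX₂X') subset_rfl
  refine (s1.trans hT₁ hT₂ (Z' := {y}) ?_).to_sol
  intro z hz
  rw [mem_singleton_iff.1 hz]
  exact s2
end

section
/- Consider the affine control system ẋ = Ax + Bu + a on ℝⁿ and n-dimensional polytopes X, X' such that X ⊂ X', X° ∩ 𝒪 = ∅, and X'° ∩ 𝒪 ≠ ∅, where 𝒪 := {x ∈ ℝⁿ : Ax + a ∈ Im(B)}. If the system is relaxed in-block controllable (RIBC) with respect to X through X', then the pair (A,B) is controllable, i.e., rank [B AB ⋯ A^{n−1}B] = n. -/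
open Matrix Set Pointwise MeasureTheory

lemma ctrb_left_null {n m : ℕ} (A : Matrix (Fin n) (Fin n) ℝ) (B : Matrix (Fin n) (Fin m) ℝ)
    (h : ¬ Controllable A B) :
    ∃ p : Fin n → ℝ, p ≠ 0 ∧ ∀ k : ℕ, p ᵥ* (A ^ k * B) = 0 := by
  have h1 : ∃ p : Fin n → ℝ, p ≠ 0 ∧ p ᵥ* ctrbMat A B = 0 := by
    by_contra hc
    push Not at hc
    apply h
    have hinj : Function.Injective (ctrbMat A B)ᵀ.mulVecLin := by
      rw [← LinearMap.ker_eq_bot, LinearMap.ker_eq_bot']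
      intro p hp
      by_contra hp0
      apply hc p hp0
      rw [← Matrix.mulVec_transpose]
      exact hp
    have := LinearMap.finrank_range_of_inj hinj
    unfold Controllable
    rw [← Matrix.rank_transpose]
    unfold Matrix.rank
    rw [this]; simp
  obtain ⟨p, hp, hp0⟩ := h1
  refine ⟨p, hp, ?_⟩
  have hlt : ∀ k < n, p ᵥ* (A ^ k * B) = 0 := by
    intro k hk
    ext j
    have := congrFun hp0 (⟨k, hk⟩, j)
    simpa [Matrix.vecMul, dotProduct, ctrbMat] using this
  intro k
  rw [Matrix.pow_eq_aeval_mod_charpoly, Polynomial.aeval_eq_sum_range, Matrix.sum_mul,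
    Matrix.vecMul_sum]
  apply Finset.sum_eq_zero
  intro i hi
  rw [Matrix.smul_mul, Matrix.vecMul_smul]
  by_cases hin : i < n
  · rw [hlt i hin, smul_zero]
  · have : (Polynomial.X ^ k %ₘ A.charpoly).coeff i = 0 := by
      apply Polynomial.coeff_eq_zero_of_degree_lt
      refine lt_of_lt_of_le (Polynomial.degree_modByMonic_lt _ A.charpoly_monic) ?_
      rw [Matrix.charpoly_degree_eq_dim]
      simpa using hin
    rw [this, zero_smul]

lemma exists_left_eigen {n m : ℕ} (A : Matrix (Fin n) (Fin n) ℝ) (B : Matrix (Fin n) (Fin m) ℝ)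
    (h : ¬ Controllable A B) :
    ∃ (L : (Fin n → ℝ) →L[ℝ] ℂ) (c : ℂ), (∃ v, L v ≠ 0) ∧
      (∀ x, L (A.mulVec x) = c * L x) ∧ ∀ u, L (B.mulVec u) = 0 := by
  obtain ⟨p, hp, hk⟩ := ctrb_left_null A B h
  set A' := A.map (Complex.ofRealHom) with hA'
  set B' := B.map (Complex.ofRealHom) with hB'
  let W : Submodule ℂ (Fin n → ℂ) :=
    { carrier := {w | ∀ k : ℕ, w ᵥ* (A' ^ k * B') = 0}
      add_mem' := by
        intro x y hx hy k
        rw [Matrix.add_vecMul, hx k, hy k, add_zero]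
      zero_mem' := by intro k; simp
      smul_mem' := by
        intro c x hx k
        rw [Matrix.smul_vecMul, hx k, smul_zero] }
  have hpW : (fun i => (p i : ℂ)) ∈ W := by
    intro k
    have := congrArg (fun v : Fin m → ℝ => fun i => (Complex.ofRealHom (v i))) (hk k)
    ext j
    have h2 := congrFun this j
    have e : A' ^ k * B' = (A ^ k * B).map Complex.ofRealHom := by
      rw [Matrix.map_mul, Matrix.map_pow]
    rw [e]
    simp only [RingHom.map_vecMul] at h2
    exact h2.trans (by simp)
  have hinv : ∀ w ∈ W, A'.vecMulLinear w ∈ W := by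
    intro w hw k
    have := hw (k + 1)
    rw [pow_succ', Matrix.mul_assoc, ← Matrix.vecMul_vecMul] at this
    exact this
  have : Nontrivial W := by
    refine ⟨⟨⟨_, hpW⟩, 0, ?_⟩⟩
    intro h0
    apply hp
    ext i
    have := congrFun (congrArg Subtype.val h0) i
    simpa using this
  obtain ⟨c, hc⟩ := Module.End.exists_eigenvalue (A'.vecMulLinear.restrict hinv)
  obtain ⟨w, hw⟩ := hc.exists_hasEigenvector
  have hwA : w.1 ᵥ* A' = c • w.1 := congrArg Subtype.val hw.apply_eq_smul
  have hw0 : w.1 ≠ 0 := fun h => hw.2 (Subtype.ext h)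
  have hwB : w.1 ᵥ* B' = 0 := by simpa using w.2 0
  let L0 : (Fin n → ℝ) →ₗ[ℝ] ℂ :=
    { toFun := fun x => w.1 ⬝ᵥ (Complex.ofRealHom ∘ x)
      map_add' := by
        intro x y
        rw [← dotProduct_add]; congr 1; ext i; simp
      map_smul' := by
        intro r x
        simp only [dotProduct, Finset.smul_sum]
        apply Finset.sum_congr rfl
        intro i _
        simp; ring }
  have hL0 : ∀ x, L0 x = w.1 ⬝ᵥ (Complex.ofRealHom ∘ x) := fun _ => rfl
  refine ⟨LinearMap.toContinuousLinearMap L0, c, ?_, ?_, ?_⟩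
  · obtain ⟨i, hi⟩ := Function.ne_iff.mp hw0
    refine ⟨Pi.single i 1, ?_⟩
    rw [LinearMap.coe_toContinuousLinearMap', hL0]
    have : (Complex.ofRealHom ∘ (Pi.single i 1 : Fin n → ℝ)) = Pi.single i 1 := by
      ext j
      by_cases hj : j = i
      · subst hj; simp
      · simp [hj]
    rw [this]
    simpa using hi
  · intro x
    rw [LinearMap.coe_toContinuousLinearMap', hL0, hL0]
    have : Complex.ofRealHom ∘ (A *ᵥ x) = A' *ᵥ (Complex.ofRealHom ∘ x) := by
      ext i; exact RingHom.map_mulVec _ _ _ _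
    rw [this, Matrix.dotProduct_mulVec, hwA, smul_dotProduct, smul_eq_mul]
  · intro x
    rw [LinearMap.coe_toContinuousLinearMap', hL0]
    have : Complex.ofRealHom ∘ (B *ᵥ x) = B' *ᵥ (Complex.ofRealHom ∘ x) := by
      ext i; exact RingHom.map_mulVec _ _ _ _
    rw [this, Matrix.dotProduct_mulVec, hwB, zero_dotProduct]

lemma scalar_ode (ζ : ℝ → ℂ) (c z : ℂ) (T : ℝ) (hT : 0 ≤ T) (hc : ContinuousOn ζ (Icc 0 T))
    (h : ∀ t ∈ Icc (0 : ℝ) T, ζ t = z + ∫ s in (0 : ℝ)..t, c * ζ s) :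
    ζ T = Complex.exp (c * T) * z := by
  let g : ℝ → ℂ := IccExtend hT ((Icc 0 T).domRestrict ζ)
  have hg : Continuous g := (continuousOn_iff_continuous_domRestrict.mp hc).Icc_extend'
  have hgζ : ∀ t ∈ Icc (0 : ℝ) T, g t = ζ t := by
    intro t ht
    simp only [g]
    rw [IccExtend_of_mem _ _ ht]; rfl
  let G : ℝ → ℂ := fun t => z + ∫ s in (0 : ℝ)..t, c * g s
  have hG : ∀ t, HasDerivAt G (c * g t) t := by
    intro t
    exact ((continuous_const.mul hg).integral_hasStrictDerivAt 0 t).hasDerivAt.const_add z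
  have hGζ : ∀ t ∈ Icc (0 : ℝ) T, G t = ζ t := by
    intro t ht
    rw [h t ht]
    simp only [G]
    congr 1
    apply intervalIntegral.integral_congr
    intro s hs
    rw [uIcc_of_le ht.1] at hs
    simp only
    rw [hgζ s ⟨hs.1, hs.2.trans ht.2⟩]
  let H : ℝ → ℂ := fun t => Complex.exp (-c * t) * G t
  have hH : ∀ t : ℝ, HasDerivAt H (Complex.exp (-c * t) * (-c) * G t +
      Complex.exp (-c * t) * (c * g t)) t := by
    intro t
    have h1 : HasDerivAt (fun t : ℝ => -c * (t : ℂ)) (-c) t := by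
      simpa using (Complex.ofRealCLM.hasDerivAt (x := t)).const_mul (-c)
    exact h1.cexp.mul (hG t)
  have hconst := constant_of_has_deriv_right_zero (f := H) (a := 0) (b := T)
    (fun t _ => (hH t).continuousAt.continuousWithinAt) (by
      intro t ht
      have ht' : t ∈ Icc (0 : ℝ) T := ⟨ht.1, ht.2.le⟩
      have := (hH t).hasDerivWithinAt (s := Ici t)
      rw [hGζ t ht', hgζ t ht'] at this
      convert this using 1
      ring)
  have := hconst T ⟨hT, le_rfl⟩
  simp only [H] at this
  rw [hGζ T ⟨hT, le_rfl⟩] at this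
  have hG0 : G 0 = z := by simp [G]
  rw [hG0] at this
  simp only [Complex.ofReal_zero, mul_zero, Complex.exp_zero, one_mul] at this
  rw [← this, ← mul_assoc, ← Complex.exp_add]
  simp

lemma sol_flow {n m : ℕ} (A : Matrix (Fin n) (Fin n) ℝ) (B : Matrix (Fin n) (Fin m) ℝ)
    (a : Fin n → ℝ) (L : (Fin n → ℝ) →L[ℝ] ℂ) (c : ℂ)
    (hA : ∀ x, L (A.mulVec x) = c * L x) (hB : ∀ u, L (B.mulVec u) = 0)
    (x0 : Fin n → ℝ) (hx0 : x0 ∈ equilSet A B a)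
    (u : ℝ → Fin m → ℝ) (φ : ℝ → Fin n → ℝ) (T : ℝ) (hT : 0 ≤ T)
    (h : IsSol A B a u φ T) (hne : φ 0 ≠ φ T) :
    L (φ T - x0) = Complex.exp (c * T) * L (φ 0 - x0) := by
  obtain ⟨u0, hu0⟩ := hx0
  have hLa : L a = - (c * L x0) := by
    have := congrArg L hu0
    rw [map_add, hA, hB] at this
    linear_combination this
  have hint : IntervalIntegrable (fun s => A.mulVec (φ s) + B.mulVec (u s) + a) volume 0 T := by
    by_contra hni
    apply hne
    have := h T ⟨hT, le_rfl⟩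
    rw [intervalIntegral.integral_undef hni, add_zero] at this
    exact this.symm
  have hφ : ContinuousOn φ (Icc 0 T) := by
    have h1 : ContinuousOn (fun t => φ 0 + ∫ s in (0 : ℝ)..t,
        (A.mulVec (φ s) + B.mulVec (u s) + a)) (Icc 0 T) := by
      have := intervalIntegral.continuousOn_primitive_interval' hint (left_mem_uIcc)
      rw [uIcc_of_le hT] at this
      exact continuousOn_const.add this
    exact h1.congr (fun t ht => h t ht)
  apply scalar_ode (fun t => L (φ t - x0)) c (L (φ 0 - x0)) T hT
  · exact L.continuous.comp_continuousOn (hφ.sub continuousOn_const)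
  · intro t ht
    have hint' := hint.mono_set (c := 0) (d := t)
      (by rw [uIcc_of_le hT, uIcc_of_le ht.1]; exact Icc_subset_Icc le_rfl ht.2)
    have e := L.intervalIntegral_comp_comm hint'
    have e2 : ∀ s, L (A.mulVec (φ s) + B.mulVec (u s) + a) = c * L (φ s - x0) := by
      intro s
      rw [map_add, map_add, hA, hB, hLa, map_sub]; ring
    simp only [e2] at e
    rw [e, ← map_add]
    congr 1
    conv_lhs => rw [h t ht]
    abel

theorem stmt8 {n m : ℕ} (A : Matrix (Fin n) (Fin n) ℝ) (B : Matrix (Fin n) (Fin m) ℝ)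
    (a : Fin n → ℝ) (hB : B.rank = m) (X X' : Set (Fin n → ℝ))
    (hX : IsNPolytope X) (hX' : IsNPolytope X') (hXX' : X ⊂ X')
    (hO1 : interior X ∩ equilSet A B a = ∅)
    (hO2 : (interior X' ∩ equilSet A B a).Nonempty)
    (hRIBC : RIBC A B a X X') :
    Controllable A B := by
  by_contra hcon
  obtain ⟨L, c, ⟨v, hv⟩, hLA, hLB⟩ := exists_left_eigen A B hcon
  obtain ⟨x0, -, hx0⟩ := hO2
  obtain ⟨M, -, hR⟩ := hRIBC
  have key : ∀ x ∈ interior X, ∀ y ∈ interior X, ∃ T ≥ (0 : ℝ),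
      ‖L (y - x0)‖ = Real.exp (c.re * T) * ‖L (x - x0)‖ := by
    intro x hx y hy
    by_cases hxy : x = y
    · subst hxy
      exact ⟨0, le_rfl, by simp⟩
    obtain ⟨T, hT, u, φ, -, hsol, h0, h1, -, -⟩ := hR x hx y hy
    refine ⟨T, hT, ?_⟩
    have := sol_flow A B a L c hLA hLB x0 hx0 u φ T hT hsol (by rw [h0, h1]; exact hxy)
    rw [h0, h1] at this
    rw [this, norm_mul, Complex.norm_exp]
    simp
  have hconst : ∀ x ∈ interior X, ∀ y ∈ interior X, ‖L (y - x0)‖ = ‖L (x - x0)‖ := by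
    rcases le_total 0 c.re with hc | hc
    · have : ∀ x ∈ interior X, ∀ y ∈ interior X, ‖L (x - x0)‖ ≤ ‖L (y - x0)‖ := by
        intro x hx y hy
        obtain ⟨T, hT, h⟩ := key x hx y hy
        rw [h]
        exact le_mul_of_one_le_left (norm_nonneg _) (Real.one_le_exp (mul_nonneg hc hT))
      exact fun x hx y hy => le_antisymm (this y hy x hx) (this x hx y hy)
    · have : ∀ x ∈ interior X, ∀ y ∈ interior X, ‖L (y - x0)‖ ≤ ‖L (x - x0)‖ := by
        intro x hx y hy
        obtain ⟨T, hT, h⟩ := key x hx y hy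
        rw [h]
        exact mul_le_of_le_one_left (norm_nonneg _)
          (Real.exp_le_one_iff.mpr (mul_nonpos_of_nonpos_of_nonneg hc hT))
      exact fun x hx y hy => le_antisymm (this x hx y hy) (this y hy x hx)
  obtain ⟨x, hx⟩ := hX.2
  have hcont : Filter.Tendsto (fun s : ℝ => x + s • v) (nhds 0) (nhds x) := by
    have : Continuous (fun s : ℝ => x + s • v) := by fun_prop
    simpa using this.tendsto 0
  have hev := hcont.eventually (isOpen_interior.mem_nhds hx)
  obtain ⟨ε, hε, hball⟩ := Metric.eventually_nhds_iff.mp hev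
  have hp : x + (ε / 2) • v ∈ interior X :=
    hball (by rw [Real.dist_eq, sub_zero, abs_of_pos (by positivity)]; linarith)
  have hm : x + (-(ε / 2)) • v ∈ interior X :=
    hball (by rw [Real.dist_eq, sub_zero, abs_neg, abs_of_pos (by positivity)]; linarith)
  have e1 := hconst x hx _ hp
  have e2 := hconst x hx _ hm
  have f1 : L (x + (ε / 2) • v - x0) = L (x - x0) + L ((ε / 2) • v) := by
    rw [← map_add]; congr 1; abel
  have f2 : L (x + (-(ε / 2)) • v - x0) = L (x - x0) - L ((ε / 2) • v) := by
    rw [← map_sub, neg_smul]; congr 1; abel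
  rw [f1] at e1
  rw [f2] at e2
  have par := parallelogram_law_with_norm ℝ (L (x - x0)) (L ((ε / 2) • v))
  rw [e1, e2] at par
  have hz : ‖L ((ε / 2) • v)‖ = 0 := by nlinarith [norm_nonneg (L ((ε / 2) • v))]
  rw [norm_eq_zero, map_smul, smul_eq_zero] at hz
  rcases hz with hz | hz
  · linarith
  · exact hv hz
end

section
/- Consider the affine control system ẋ = Ax + Bu + a on ℝⁿ and n-dimensional polytopes X, X' such that X ⊂ X', X° ∩ 𝒪 = ∅, and X'° ∩ 𝒪 ≠ ∅, where 𝒪 := {x ∈ ℝⁿ : Ax + a ∈ Im(B)}. If the system is relaxed in-block controllable (RIBC) with respect to X through X', then there exists an n-dimensional compact convex set X₁ such that (i) X ⊂ X₁ ⊆ X', (ii) X₁° ∩ 𝒪 ≠ ∅, (iii) for each x ∈ ∂X₁ there exists u ∈ ℝ^m with Ax + Bu + a ∈ T_{X₁}(x), and (iv) for each x ∈ ∂X₁ there exists u ∈ ℝ^m with −Ax − Bu − a ∈ T_{X₁}(x), where T_{X₁}(x) is the Bouligand tangent cone to X₁ at x. -/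
open Matrix Set Pointwise MeasureTheory

lemma bouligand_of_seq {n : ℕ} {S : Set (Fin n → ℝ)} {x v : Fin n → ℝ}
    (t : ℕ → ℝ) (ht0 : ∀ k, 0 < t k) (ht : Filter.Tendsto t Filter.atTop (nhds 0))
    (h : Filter.Tendsto (fun k => Metric.infDist (x + t k • v) S / t k) Filter.atTop (nhds 0)) :
    v ∈ bouligand S x := by
  have hpos : ∀ᶠ s : ℝ in nhdsWithin 0 (Set.Ioi 0), 0 ≤ Metric.infDist (x + s • v) S / s := by
    filter_upwards [self_mem_nhdsWithin] with s hs
    exact div_nonneg Metric.infDist_nonneg (le_of_lt hs)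
  have htt : Filter.Tendsto t Filter.atTop (nhdsWithin 0 (Set.Ioi 0)) :=
    tendsto_nhdsWithin_iff.2 ⟨ht, Filter.Eventually.of_forall ht0⟩
  have hfreq : ∀ ε > 0, ∃ᶠ s : ℝ in nhdsWithin 0 (Set.Ioi 0),
      Metric.infDist (x + s • v) S / s ≤ ε := by
    intro ε hε
    apply htt.frequently
    apply Filter.Eventually.frequently
    filter_upwards [h.eventually (gt_mem_nhds hε)] with k hk
    exact hk.le
  have hbd : Filter.IsBoundedUnder (· ≥ ·) (nhdsWithin (0:ℝ) (Set.Ioi 0))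
      (fun s : ℝ => Metric.infDist (x + s • v) S / s) := ⟨0, by simpa using hpos⟩
  show Filter.liminf _ _ = 0
  apply le_antisymm
  · apply le_of_forall_pos_le_add
    intro ε hε
    rw [zero_add]
    exact Filter.liminf_le_of_frequently_le (hfreq ε hε) hbd
  · apply Filter.le_liminf_of_le _ hpos
    exact Filter.IsCoboundedUnder.of_frequently_le (hfreq 1 one_pos)

lemma viab_tangent {n m : ℕ} (A : (Fin n → ℝ) →L[ℝ] (Fin n → ℝ))
    (B : (Fin m → ℝ) →L[ℝ] (Fin n → ℝ)) (a : Fin n → ℝ) (R : Set (Fin n → ℝ))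
    (hc : IsCompact (closure (convexHull ℝ R))) (M C τ : ℝ) (hτ : 0 < τ)
    (hstep : ∀ z ∈ R, ∀ t ∈ Set.Ioc 0 τ, ∃ u : Fin m → ℝ, ‖u‖ ≤ M ∧ ∃ w ∈ R,
      ‖w - z - t • (A z + B u + a)‖ ≤ C * t ^ 2) :
    ∀ x ∈ closure (convexHull ℝ R), ∃ u : Fin m → ℝ,
      A x + B u + a ∈ bouligand (closure (convexHull ℝ R)) x := by
  set X₁ := closure (convexHull ℝ R) with hX₁
  have hRX : R ⊆ X₁ := (subset_convexHull ℝ R).trans subset_closure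
  have hcv : Convex ℝ X₁ := (convex_convexHull ℝ R).closure
  have key : ∀ x ∈ X₁, ∀ t ∈ Set.Ioc 0 τ, ∃ u : Fin m → ℝ, ‖u‖ ≤ M ∧ ∃ w ∈ X₁,
      ‖w - x - t • (A x + B u + a)‖ ≤ C * t ^ 2 := by
    intro x hx t ht
    let L : ((Fin n → ℝ) × (Fin m → ℝ) × (Fin n → ℝ)) →L[ℝ] (Fin n → ℝ) :=
      ContinuousLinearMap.fst ℝ _ _ + t • (A.comp (ContinuousLinearMap.fst ℝ _ _)
        + B.comp ((ContinuousLinearMap.fst ℝ _ _).comp (ContinuousLinearMap.snd ℝ _ _)))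
        + (ContinuousLinearMap.snd ℝ _ _).comp (ContinuousLinearMap.snd ℝ _ _)
    let P : Set ((Fin n → ℝ) × (Fin m → ℝ) × (Fin n → ℝ)) :=
      (X₁ ×ˢ (Metric.closedBall 0 M ×ˢ Metric.closedBall 0 (C * t ^ 2))) ∩
        (L ⁻¹' ((fun z => z + t • a) ⁻¹' X₁))
    have hPc : IsCompact P := by
      apply IsCompact.inter_right
      · exact hc.prod ((isCompact_closedBall _ _).prod (isCompact_closedBall _ _))
      · exact ((isClosed_closure).preimage (by fun_prop)).preimage L.continuous
    have hPv : Convex ℝ P := by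
      apply Convex.inter
      · exact hcv.prod ((convex_closedBall _ _).prod (convex_closedBall _ _))
      · exact (hcv.translate_preimage_left _).linear_preimage L.toLinearMap
    have hsub : X₁ ⊆ (ContinuousLinearMap.fst ℝ (Fin n → ℝ) ((Fin m → ℝ) × (Fin n → ℝ))) '' P := by
      apply closure_minimal
      · apply convexHull_min
        · intro z hz
          obtain ⟨u, hu, w, hw, hwz⟩ := hstep z hz t ht
          refine ⟨(z, u, w - z - t • (A z + B u + a)), ⟨⟨hRX hz, ?_, ?_⟩, ?_⟩, rfl⟩
          · simpa using hu
          · simpa using hwz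
          · show (z + t • (A z + B u) + (w - z - t • (A z + B u + a))) + t • a ∈ X₁
            convert hRX hw using 1
            module
        · exact hPv.linear_image
            (ContinuousLinearMap.fst ℝ (Fin n → ℝ) ((Fin m → ℝ) × (Fin n → ℝ))).toLinearMap
      · exact (hPc.image (ContinuousLinearMap.continuous _)).isClosed
    obtain ⟨⟨x', u, e⟩, ⟨⟨_, hu, he⟩, hL⟩, rfl⟩ := hsub hx
    refine ⟨u, by simpa using hu, _, hL, ?_⟩
    have : (L (x', u, e) + t • a) - x' - t • (A x' + B u + a) = e := by
      show (x' + t • (A x' + B u) + e) + t • a - x' - t • (A x' + B u + a) = e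
      module
    show ‖(L (x', u, e) + t • a) - x' - t • (A x' + B u + a)‖ ≤ _
    rw [this]
    simpa using he
  intro x hx
  have htk : ∀ k : ℕ, τ / (k + 1) ∈ Set.Ioc 0 τ := fun k =>
    ⟨by positivity, div_le_self hτ.le (by linarith [k.cast_nonneg (α := ℝ)])⟩
  choose u hu w hw hwx using fun k : ℕ => key x hx _ (htk k)
  obtain ⟨u0, -, ψ, hψ, hlim⟩ := (isCompact_closedBall (0 : Fin m → ℝ) M).tendsto_subseq
    (x := u) (fun k => by simpa using hu k)
  have hT : Filter.Tendsto (fun k : ℕ => τ / ((k:ℝ) + 1)) Filter.atTop (nhds 0) := by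
    simpa [div_eq_mul_inv] using tendsto_one_div_add_atTop_nhds_zero_nat (𝕜 := ℝ) |>.const_mul τ
  have hT' : Filter.Tendsto (fun k : ℕ => τ / ((ψ k:ℝ) + 1)) Filter.atTop (nhds 0) :=
    hT.comp hψ.tendsto_atTop
  refine ⟨u0, bouligand_of_seq (fun k => τ / ((ψ k : ℝ) + 1)) (fun k => (htk _).1) hT' ?_⟩
  have hup : Filter.Tendsto (fun k : ℕ => ‖B (u0 - u (ψ k))‖ + C * (τ / ((ψ k:ℝ) + 1)))
      Filter.atTop (nhds 0) := by
    have h1 : Filter.Tendsto (fun k : ℕ => ‖B (u0 - u (ψ k))‖) Filter.atTop (nhds 0) := by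
      have h2 : Filter.Tendsto (fun k : ℕ => u0 - u (ψ k)) Filter.atTop (nhds (u0 - u0)) :=
        hlim.const_sub u0
      have := ((B.continuous.tendsto _).comp h2).norm
      simpa using this
    simpa using h1.add (hT'.const_mul C)
  refine squeeze_zero (fun k => div_nonneg Metric.infDist_nonneg (htk _).1.le) (fun k => ?_) hup
  have hp := (htk (ψ k)).1
  set t := τ / ((ψ k : ℝ) + 1)
  rw [div_le_iff₀ hp]
  calc Metric.infDist (x + t • (A x + B u0 + a)) X₁ ≤ dist (x + t • (A x + B u0 + a)) (w (ψ k)) :=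
        Metric.infDist_le_dist_of_mem (hw _)
    _ = ‖t • B (u0 - u (ψ k)) - (w (ψ k) - x - t • (A x + B (u (ψ k)) + a))‖ := by
        rw [dist_eq_norm, map_sub]; congr 1; module
    _ ≤ ‖t • B (u0 - u (ψ k))‖ + C * t ^ 2 := (norm_sub_le _ _).trans (by gcongr; exact hwx _)
    _ = _ := by rw [norm_smul, Real.norm_of_nonneg hp.le]; ring

/-- One approximate Euler step. -/
def EStep {n m : ℕ} (A : (Fin n → ℝ) →L[ℝ] (Fin n → ℝ))
    (B : (Fin m → ℝ) →L[ℝ] (Fin n → ℝ)) (a : Fin n → ℝ) (M K : ℝ)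
    (z : Fin n → ℝ) (t : ℝ) (w : Fin n → ℝ) : Prop :=
  ‖w - z‖ ≤ K * t ∧ ∃ u : Fin m → ℝ, ‖u‖ ≤ M ∧ ‖w - z - t • (A z + B u + a)‖ ≤ ‖A‖ * K * t ^ 2

lemma EStep.comp {n m : ℕ} {A : (Fin n → ℝ) →L[ℝ] (Fin n → ℝ)}
    {B : (Fin m → ℝ) →L[ℝ] (Fin n → ℝ)} {a : Fin n → ℝ} {M K : ℝ} (hK : 0 ≤ K)
    {x y z : Fin n → ℝ} {s t : ℝ} (hs : 0 ≤ s) (ht : 0 < t)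
    (h1 : EStep A B a M K x s y) (h2 : EStep A B a M K y t z) :
    EStep A B a M K x (s + t) z := by
  obtain ⟨h1, u, hu, hxu⟩ := h1
  obtain ⟨h2, v, hv, hyv⟩ := h2
  have hst : 0 < s + t := by linarith
  refine ⟨?_, (s / (s + t)) • u + (t / (s + t)) • v, ?_, ?_⟩
  · calc ‖z - x‖ = ‖(z - y) + (y - x)‖ := by congr 1; module
      _ ≤ K * t + K * s := (norm_add_le _ _).trans (by gcongr)
      _ = _ := by ring
  · calc _ ≤ (s / (s + t)) * ‖u‖ + (t / (s + t)) * ‖v‖ := by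
          refine (norm_add_le _ _).trans ?_
          rw [norm_smul, norm_smul, Real.norm_of_nonneg (by positivity),
            Real.norm_of_nonneg (by positivity)]
      _ ≤ (s / (s + t)) * M + (t / (s + t)) * M := by gcongr
      _ = M := by field_simp
  · have e : (s + t) • (A x + B ((s / (s + t)) • u + (t / (s + t)) • v) + a)
        = (s + t) • (A x + a) + s • B u + t • B v := by
      rw [map_add, map_smul, map_smul, smul_add, smul_add, smul_add, smul_smul, smul_smul,
        mul_div_cancel₀ _ hst.ne', mul_div_cancel₀ _ hst.ne']
      module
    rw [e]
    calc _ = ‖(y - x - s • (A x + B u + a)) + (z - y - t • (A y + B v + a)) + t • A (y - x)‖ := by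
          rw [map_sub]; congr 1; module
      _ ≤ ‖A‖ * K * s ^ 2 + ‖A‖ * K * t ^ 2 + t * (‖A‖ * (K * s)) := by
          refine (norm_add₃_le).trans ?_
          rw [norm_smul, Real.norm_of_nonneg ht.le]
          gcongr
          exact (A.le_opNorm _).trans (by gcongr)
      _ ≤ _ := by
          have : 0 ≤ ‖A‖ * K * (s * t) := by positivity
          nlinarith

lemma steps_of_paths {n m : ℕ} {A : (Fin n → ℝ) →L[ℝ] (Fin n → ℝ)}
    {B : (Fin m → ℝ) →L[ℝ] (Fin n → ℝ)} {a : Fin n → ℝ} {M K : ℝ} (hK : 0 ≤ K) {τ : ℝ}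
    {R D : Set (Fin n → ℝ)}
    (hpath : ∀ z ∈ R, ∃ T ≥ (0:ℝ), ∃ y ∈ D, EStep A B a M K z T y ∧
      ∀ s ∈ Set.Icc 0 T, ∃ w ∈ R, EStep A B a M K z s w)
    (hD : ∀ y ∈ D, ∀ s ∈ Set.Icc 0 τ, ∃ w ∈ R, EStep A B a M K y s w) :
    ∀ z ∈ R, ∀ t ∈ Set.Ioc 0 τ, ∃ u : Fin m → ℝ, ‖u‖ ≤ M ∧ ∃ w ∈ R,
      ‖w - z - t • (A z + B u + a)‖ ≤ (‖A‖ * K) * t ^ 2 := by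
  intro z hz t ht
  suffices ∃ w ∈ R, EStep A B a M K z t w by
    obtain ⟨w, hw, -, u, hu, h⟩ := this
    exact ⟨u, hu, w, hw, h⟩
  obtain ⟨T, hT, y, hy, hzy, h⟩ := hpath z hz
  rcases le_or_gt t T with htT | htT
  · exact h t ⟨ht.1.le, htT⟩
  · obtain ⟨w, hw, hyw⟩ := hD y hy (t - T) ⟨by linarith, by linarith [ht.2]⟩
    refine ⟨w, hw, ?_⟩
    have := EStep.comp hK hT (by linarith) hzy hyw
    simpa using this

lemma sol_integrable {n m : ℕ} {A : (Fin n → ℝ) →L[ℝ] (Fin n → ℝ)}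
    {B : (Fin m → ℝ) →L[ℝ] (Fin n → ℝ)} {a : Fin n → ℝ} {u : ℝ → Fin m → ℝ}
    {φ : ℝ → Fin n → ℝ} {T K : ℝ} (hT : 0 ≤ T) (hu : Measurable u)
    (hsol : ∀ t ∈ Set.Icc 0 T, φ t = φ 0 + ∫ s in (0:ℝ)..t, (A (φ s) + B (u s) + a))
    (hK : ∀ s ∈ Set.Icc 0 T, ‖A (φ s) + B (u s) + a‖ ≤ K) :
    IntervalIntegrable (fun s => A (φ s) + B (u s) + a) volume 0 T := by
  set g : ℝ → Fin n → ℝ := fun s => A (φ s) + B (u s) + a with hg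
  let S : Set ℝ := {t | t ∈ Set.Icc 0 T ∧ IntervalIntegrable g volume 0 t}
  have h0S : (0:ℝ) ∈ S := ⟨⟨le_refl _, hT⟩, by simp⟩
  have hSb : BddAbove S := ⟨T, fun t ht => ht.1.2⟩
  have hc0 : 0 ≤ sSup S := le_csSup hSb h0S
  have hcT : sSup S ≤ T := csSup_le ⟨0, h0S⟩ fun t ht => ht.1.2
  have hcont : ContinuousOn φ (Set.Ico 0 (sSup S)) := by
    intro t ht
    obtain ⟨s, hs, hts⟩ := exists_lt_of_lt_csSup ⟨0, h0S⟩ ht.2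
    have hc : ContinuousOn φ (Set.Icc 0 s) := by
      have h1 : ContinuousOn (fun t => φ 0 + ∫ s in (0:ℝ)..t, g s) (Set.Icc 0 s) := by
        apply continuousOn_const.add
        have := intervalIntegral.continuousOn_primitive_interval' hs.2
          (a := 0) (Set.left_mem_uIcc)
        rwa [Set.uIcc_of_le hs.1.1] at this
      exact h1.congr fun r hr => hsol r ⟨hr.1, hr.2.trans hs.1.2⟩
    have h2 := hc t ⟨ht.1, hts.le⟩
    apply h2.mono_of_mem_nhdsWithin
    rw [mem_nhdsWithin]
    exact ⟨Set.Iio s, isOpen_Iio, hts, fun r hr => ⟨hr.2.1, le_of_lt hr.1⟩⟩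
  have hφ : AEStronglyMeasurable φ (volume.restrict (Set.Ioc 0 T)) := by
    rw [← Set.Ioc_union_Ioc_eq_Ioc hc0 hcT, aestronglyMeasurable_union_iff]
    constructor
    · rw [← Measure.restrict_congr_set Ico_ae_eq_Ioc]
      exact hcont.aestronglyMeasurable measurableSet_Ico
    · have h1 : AEStronglyMeasurable (fun _ : ℝ => φ 0) (volume.restrict (Set.Ioc (sSup S) T)) :=
        aestronglyMeasurable_const
      refine h1.congr ?_
      filter_upwards [ae_restrict_mem measurableSet_Ioc] with t ht
      have htI : t ∈ Set.Icc 0 T := ⟨hc0.trans ht.1.le, ht.2⟩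
      have hni : ¬ IntervalIntegrable g volume 0 t := fun h =>
        absurd (le_csSup hSb (show t ∈ S from ⟨htI, h⟩)) (not_le.2 ht.1)
      have := hsol t htI
      rw [intervalIntegral.integral_undef hni, add_zero] at this
      exact this.symm
  have hgm : AEStronglyMeasurable g (volume.restrict (Set.Ioc 0 T)) :=
    ((A.continuous.comp_aestronglyMeasurable hφ).add
      (B.continuous.measurable.comp hu).aestronglyMeasurable).add aestronglyMeasurable_const
  rw [intervalIntegrable_iff_integrableOn_Ioc_of_le hT]
  refine Integrable.of_bound hgm K ?_
  filter_upwards [ae_restrict_mem measurableSet_Ioc] with t ht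
  exact hK t ⟨ht.1.le, ht.2⟩

lemma sol_step {n m : ℕ} {A : (Fin n → ℝ) →L[ℝ] (Fin n → ℝ)}
    {B : (Fin m → ℝ) →L[ℝ] (Fin n → ℝ)} {a : Fin n → ℝ} {u : ℝ → Fin m → ℝ}
    {φ : ℝ → Fin n → ℝ} {T K M : ℝ} (hT : 0 ≤ T) (hM : 0 ≤ M) (hu : Measurable u)
    (hsol : ∀ t ∈ Set.Icc 0 T, φ t = φ 0 + ∫ s in (0:ℝ)..t, (A (φ s) + B (u s) + a))
    (hK : ∀ s ∈ Set.Icc 0 T, ‖A (φ s) + B (u s) + a‖ ≤ K)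
    (huM : ∀ s ∈ Set.Icc 0 T, ‖u s‖ ≤ M) :
    ∀ s s' : ℝ, 0 ≤ s → s ≤ s' → s' ≤ T → ‖φ s' - φ s‖ ≤ K * (s' - s) ∧
      ∃ v : Fin m → ℝ, ‖v‖ ≤ M ∧ ∀ r ∈ Set.Icc s s',
        ‖φ s' - φ s - (s' - s) • (A (φ r) + B v + a)‖ ≤ ‖A‖ * K * (s' - s) ^ 2 := by
  have hint := sol_integrable hT hu hsol hK
  have hint' : ∀ s s' : ℝ, 0 ≤ s → s ≤ s' → s' ≤ T →
      IntervalIntegrable (fun s => A (φ s) + B (u s) + a) volume s s' := by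
    intro s s' h1 h2 h3
    apply hint.mono_set
    rw [Set.uIcc_of_le h2, Set.uIcc_of_le hT]
    exact Set.Icc_subset_Icc h1 h3
  have hdiff : ∀ s s' : ℝ, 0 ≤ s → s ≤ s' → s' ≤ T →
      φ s' - φ s = ∫ r in s..s', (A (φ r) + B (u r) + a) := by
    intro s s' h1 h2 h3
    rw [hsol s' ⟨h1.trans h2, h3⟩, hsol s ⟨h1, h2.trans h3⟩, add_sub_add_left_eq_sub,
      intervalIntegral.integral_interval_sub_left (hint' _ _ le_rfl (h1.trans h2) h3)
      (hint' _ _ le_rfl h1 (h2.trans h3))]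
  have hlip : ∀ s s' : ℝ, 0 ≤ s → s ≤ s' → s' ≤ T → ‖φ s' - φ s‖ ≤ K * (s' - s) := by
    intro s s' h1 h2 h3
    rw [hdiff s s' h1 h2 h3]
    have := intervalIntegral.norm_integral_le_of_norm_le_const (a := s) (b := s')
      (f := fun r => A (φ r) + B (u r) + a) (C := K) (by
        intro r hr
        rw [Set.uIoc_of_le h2] at hr
        exact hK r ⟨h1.trans hr.1.le, hr.2.trans h3⟩)
    rwa [abs_of_nonneg (by linarith)] at this
  intro s s' h1 h2 h3
  refine ⟨hlip s s' h1 h2 h3, ?_⟩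
  have hui : IntervalIntegrable u volume s s' := by
    rw [intervalIntegrable_iff_integrableOn_Ioc_of_le h2]
    refine Measure.integrableOn_of_bounded (M := M) (by simp) hu.aestronglyMeasurable ?_
    filter_upwards [ae_restrict_mem measurableSet_Ioc] with t ht
    exact huM t ⟨h1.trans ht.1.le, ht.2.trans h3⟩
  have hun : ‖∫ r in s..s', u r‖ ≤ M * (s' - s) := by
    have := intervalIntegral.norm_integral_le_of_norm_le_const (a := s) (b := s')
      (f := u) (C := M) (by
        intro r hr
        rw [Set.uIoc_of_le h2] at hr
        exact huM r ⟨h1.trans hr.1.le, hr.2.trans h3⟩)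
    rwa [abs_of_nonneg (by linarith)] at this
  rcases h2.eq_or_lt with rfl | hlt
  · exact ⟨0, by simpa using hM, fun r _ => by simp⟩
  have hpos : 0 < s' - s := by linarith
  refine ⟨(s' - s)⁻¹ • ∫ r in s..s', u r, ?_, ?_⟩
  · rw [norm_smul, Real.norm_of_nonneg (by positivity), inv_mul_le_iff₀ hpos]
    linarith
  · intro r hr
    have hBu : IntervalIntegrable (fun r => B (u r)) volume s s' :=
      ⟨B.integrable_comp hui.1, B.integrable_comp hui.2⟩
    have e : φ s' - φ s - (s' - s) • (A (φ r) + B ((s' - s)⁻¹ • ∫ r in s..s', u r) + a)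
        = ∫ q in s..s', A (φ q - φ r) := by
      have e1 : (s' - s) • (A (φ r) + B ((s' - s)⁻¹ • ∫ r in s..s', u r) + a)
          = ∫ q in s..s', (A (φ r) + B (u q) + a) := by
        rw [intervalIntegral.integral_add (by
            exact (intervalIntegrable_const).add hBu) intervalIntegrable_const,
          intervalIntegral.integral_add intervalIntegrable_const hBu,
          intervalIntegral.integral_const, intervalIntegral.integral_const,
          ContinuousLinearMap.intervalIntegral_comp_comm B hui, map_smul, smul_add, smul_add,
          smul_smul, mul_inv_cancel₀ hpos.ne', one_smul]
      rw [e1, hdiff s s' h1 h2 h3, ← intervalIntegral.integral_sub (hint' s s' h1 h2 h3)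
        ((intervalIntegrable_const.add hBu).add intervalIntegrable_const)]
      congr 1
      ext q : 1
      rw [map_sub]
      module
    rw [e]
    have := intervalIntegral.norm_integral_le_of_norm_le_const (a := s) (b := s')
      (f := fun q => A (φ q - φ r)) (C := ‖A‖ * (K * (s' - s))) (by
        intro q hq
        rw [Set.uIoc_of_le h2] at hq
        have hK0 : 0 ≤ K := (norm_nonneg _).trans (hK s ⟨h1, h2.trans h3⟩)
        refine (A.le_opNorm _).trans ?_
        gcongr
        rcases le_total q r with hqr | hqr
        · rw [norm_sub_rev]
          refine (hlip q r (h1.trans hq.1.le) hqr (hr.2.trans h3)).trans ?_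
          gcongr
          · exact hr.2
          · exact hq.1.le
        · refine (hlip r q (h1.trans hr.1) hqr (hq.2.trans h3)).trans ?_
          gcongr
          · exact hq.2
          · exact hr.1)
    rw [abs_of_nonneg hpos.le] at this
    refine this.trans (le_of_eq (by ring))

/-- Separation argument: a set `X₁` whose interior misses the equilibrium set. -/
lemma exists_functional {n m : ℕ} (A : (Fin n → ℝ) →L[ℝ] (Fin n → ℝ))
    (B : (Fin m → ℝ) →L[ℝ] (Fin n → ℝ)) (a : Fin n → ℝ) (X₁ : Set (Fin n → ℝ))
    (hcv : Convex ℝ X₁) (hne : (interior X₁).Nonempty) (o : Fin n → ℝ) (uo : Fin m → ℝ)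
    (ho : A o + a = B uo)
    (hdis : ∀ x ∈ interior X₁, ∀ u, A x + a ≠ B u) :
    ∃ q : (Fin n → ℝ) →L[ℝ] ℝ, q ≠ 0 ∧ ∀ x ∈ X₁, ∀ u, q (A x + B u + a) ≤ 0 := by
  let O : Set (Fin n → ℝ) := {x | ∃ u, A x + a = B u}
  have hO : Convex ℝ O := by
    rintro x ⟨u, hu⟩ y ⟨v, hv⟩ r s hr hs hrs
    refine ⟨r • u + s • v, ?_⟩
    rw [map_add, map_add, map_smul, map_smul, map_smul, map_smul, ← hu, ← hv]
    calc _ = r • A x + s • A y + (1:ℝ) • a := by rw [one_smul]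
      _ = _ := by rw [← hrs]; module
  obtain ⟨f, c, hf1, hf2⟩ := geometric_hahn_banach_open hcv.interior isOpen_interior hO
    (Set.disjoint_left.2 fun x hx ⟨u, hu⟩ => hdis x hx u hu)
  have hker : ∀ d v, A d = B v → f d = 0 := by
    intro d v hd
    by_contra hne
    have := hf2 (o + ((c - 1 - f o) / f d) • d) ⟨uo + ((c - 1 - f o) / f d) • v, by
      rw [map_add, map_add, map_smul, map_smul, ← ho, hd]; abel⟩
    rw [map_add, map_smul, smul_eq_mul, div_mul_cancel₀ _ hne] at this
    linarith
  let π := (LinearMap.range B.toLinearMap).mkQ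
  have hmem : f.toLinearMap ∈ LinearMap.range (LinearMap.dualMap (π ∘ₗ A.toLinearMap)) := by
    rw [LinearMap.range_dualMap_eq_dualAnnihilator_ker, Submodule.mem_dualAnnihilator]
    intro d hd
    have : A d ∈ LinearMap.range B.toLinearMap := by
      simpa [π] using hd
    obtain ⟨v, hv⟩ := this
    exact hker d v hv.symm
  obtain ⟨q', hq'⟩ := hmem
  let q : (Fin n → ℝ) →L[ℝ] ℝ := (q' ∘ₗ π).toContinuousLinearMap
  have hqA : ∀ x, q (A x) = f x := fun x => DFunLike.congr_fun hq' x
  have hqB : ∀ u, q (B u) = 0 := by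
    intro u
    show q' (π (B u)) = 0
    have : π (B u) = 0 := by simp [π]
    rw [this, map_zero]
  have hqa : q a = - f o := by
    have := congrArg q ho
    rw [map_add, hqA, hqB] at this
    linarith
  have hco : c ≤ f o := hf2 o ⟨uo, ho⟩
  refine ⟨q, ?_, ?_⟩
  · intro h0
    obtain ⟨x, hx⟩ := hne
    have h1 := hqA x
    have h2 := hqA o
    have h3 := hf1 x hx
    rw [h0] at h1 h2
    simp at h1 h2
    linarith
  · intro x hx u
    rw [map_add, map_add, hqA, hqB, hqa]
    have hx' : x ∈ closure (interior X₁) := by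
      rw [hcv.closure_interior_eq_closure_of_nonempty_interior hne]
      exact subset_closure hx
    have : closure (interior X₁) ⊆ {x | f x ≤ c} :=
      closure_minimal (fun y hy => (hf1 y hy).le) (isClosed_le f.continuous continuous_const)
    have := this hx'
    simp only [Set.mem_ofPred_eq] at this
    linarith

lemma functional_zero_of_const {n : ℕ} {U : Set (Fin n → ℝ)} (hU : IsOpen U) (hne : U.Nonempty)
    (q : (Fin n → ℝ) →L[ℝ] ℝ) (h : ∀ x ∈ U, ∀ y ∈ U, q y - q x ≤ 0) : q = 0 := by
  obtain ⟨x, hx⟩ := hne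
  ext1 v
  have hcont : Continuous fun t : ℝ => x + t • v := by fun_prop
  have hev : ∀ᶠ t : ℝ in nhds 0, x + t • v ∈ U :=
    hcont.continuousAt.eventually (by simpa using hU.mem_nhds hx)
  obtain ⟨ε, hε, hb⟩ := Metric.eventually_nhds_iff.1 hev
  have h1 := hb (y := ε / 2) (by simp [abs_of_pos hε]; linarith)
  have h2 := h x hx _ h1
  have h3 := h _ h1 x hx
  simp only [map_add, map_smul, smul_eq_mul] at h2 h3
  have : ε / 2 * q v = 0 := by linarith
  rcases mul_eq_zero.1 this with h | h
  · linarith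
  · simpa using h

/-- Case C. If the affine system is RIBC w.r.t. `X` through `X'`, then there is an
`n`-dimensional compact convex set `X₁` with (i) `X ⊂ X₁ ⊆ X'`, (ii) `X₁° ∩ 𝒪 ≠ ∅`,
(iii) solvable invariance conditions, (iv) solvable backward invariance conditions. -/
theorem stmt9 {n m : ℕ} (A : Matrix (Fin n) (Fin n) ℝ) (B : Matrix (Fin n) (Fin m) ℝ)
    (a : Fin n → ℝ) (hB : B.rank = m) (X X' : Set (Fin n → ℝ))
    (hX : IsNPolytope X) (hX' : IsNPolytope X') (hXX' : X ⊂ X')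
    (hO1 : interior X ∩ equilSet A B a = ∅)
    (hO2 : (interior X' ∩ equilSet A B a).Nonempty)
    (hRIBC : RIBC A B a X X') :
    ∃ X₁ : Set (Fin n → ℝ), IsCompact X₁ ∧ Convex ℝ X₁ ∧ (interior X₁).Nonempty ∧
      X ⊂ X₁ ∧ X₁ ⊆ X' ∧
      (interior X₁ ∩ equilSet A B a).Nonempty ∧
      (∀ x ∈ frontier X₁, ∃ u : Fin m → ℝ,
        A.mulVec x + B.mulVec u + a ∈ bouligand X₁ x) ∧
      (∀ x ∈ frontier X₁, ∃ u : Fin m → ℝ,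
        -(A.mulVec x) - B.mulVec u - a ∈ bouligand X₁ x) := by
  obtain ⟨M, hM, hR⟩ := hRIBC
  let A' : (Fin n → ℝ) →L[ℝ] (Fin n → ℝ) := A.mulVecLin.toContinuousLinearMap
  let B' : (Fin m → ℝ) →L[ℝ] (Fin n → ℝ) := B.mulVecLin.toContinuousLinearMap
  obtain ⟨⟨V, hV⟩, hXne⟩ := hX
  obtain ⟨⟨V', hV'⟩, -⟩ := hX'
  have hXcl : IsClosed X := by rw [hV]; exact (V.finite_toSet.isCompact_convexHull (𝕜 := ℝ)).isClosed
  have hXcv : Convex ℝ X := by rw [hV]; exact convex_convexHull ℝ _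
  have hX'c : IsCompact X' := by rw [hV']; exact V'.finite_toSet.isCompact_convexHull (𝕜 := ℝ)
  have hX'cv : Convex ℝ X' := by rw [hV']; exact convex_convexHull ℝ _
  obtain ⟨ρ, hρ0, hρ⟩ := hX'c.isBounded.exists_pos_norm_le
  let K : ℝ := ‖A'‖ * ρ + ‖B'‖ * M + ‖a‖ + 1
  have hK0 : 0 < K := by positivity
  have hKb : ∀ x ∈ X', ∀ u : Fin m → ℝ, ‖u‖ ≤ M → ‖A' x + B' u + a‖ ≤ K := by
    intro x hx u hu
    have h1 := (A'.le_opNorm x).trans (mul_le_mul_of_nonneg_left (hρ x hx) (norm_nonneg _))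
    have h2 := (B'.le_opNorm u).trans (mul_le_mul_of_nonneg_left hu (norm_nonneg _))
    have h3 := norm_add₃_le (a := A' x) (b := B' u) (c := a)
    simp only [K]
    linarith
  let G : ℝ → (ℝ → Fin m → ℝ) → (ℝ → Fin n → ℝ) → Prop := fun T u φ =>
    0 ≤ T ∧ Measurable u ∧ IsSol A B a u φ T ∧ φ 0 ∈ interior X ∧ φ T ∈ interior X ∧
      (∀ t ∈ Set.Icc (0 : ℝ) T, ‖u t‖ ≤ M) ∧ (∀ t ∈ Set.Icc (0 : ℝ) T, φ t ∈ interior X')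
  have hGK : ∀ T u φ, G T u φ → ∀ s ∈ Set.Icc (0 : ℝ) T, ‖A' (φ s) + B' (u s) + a‖ ≤ K :=
    fun T u φ hG s hs => hKb _ (interior_subset (hG.2.2.2.2.2.2 s hs)) _ (hG.2.2.2.2.2.1 s hs)
  have hGs : ∀ T u φ, G T u φ → ∀ s s' : ℝ, 0 ≤ s → s ≤ s' → s' ≤ T →
      ‖φ s' - φ s‖ ≤ K * (s' - s) ∧ ∃ v : Fin m → ℝ, ‖v‖ ≤ M ∧ ∀ r ∈ Set.Icc s s',
        ‖φ s' - φ s - (s' - s) • (A' (φ r) + B' v + a)‖ ≤ ‖A'‖ * K * (s' - s) ^ 2 :=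
    fun T u φ hG => sol_step hG.1 hM.le hG.2.1 hG.2.2.1 (hGK T u φ hG) hG.2.2.2.2.2.1
  have hfw : ∀ T u φ, G T u φ → ∀ s s' : ℝ, 0 ≤ s → s ≤ s' → s' ≤ T →
      EStep A' B' a M K (φ s) (s' - s) (φ s') := by
    intro T u φ hG s s' h1 h2 h3
    obtain ⟨hl, v, hv, hr⟩ := hGs T u φ hG s s' h1 h2 h3
    exact ⟨hl, v, hv, hr s ⟨le_rfl, h2⟩⟩
  have hbw : ∀ T u φ, G T u φ → ∀ s s' : ℝ, 0 ≤ s → s ≤ s' → s' ≤ T →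
      EStep (-A') (-B') (-a) M K (φ s') (s' - s) (φ s) := by
    intro T u φ hG s s' h1 h2 h3
    obtain ⟨hl, v, hv, hr⟩ := hGs T u φ hG s s' h1 h2 h3
    refine ⟨by rwa [norm_sub_rev], v, hv, ?_⟩
    have := hr s' ⟨h2, le_rfl⟩
    have e1 : (-A') (φ s') = -(A' (φ s')) := rfl
    have e2 : (-B') v = -(B' v) := rfl
    have e3 : φ s - φ s' - (s' - s) • ((-A') (φ s') + (-B') v + -a)
        = -(φ s' - φ s - (s' - s) • (A' (φ s') + B' v + a)) := by
      rw [e1, e2]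
      module
    rw [norm_neg A', e3, norm_neg]
    exact this
  let R : Set (Fin n → ℝ) := {z | ∃ T u φ, G T u φ ∧ ∃ s ∈ Set.Icc (0 : ℝ) T, φ s = z}
  have hGR : ∀ T u φ, G T u φ → ∀ s ∈ Set.Icc (0 : ℝ) T, φ s ∈ R :=
    fun T u φ hG s hs => ⟨T, u, φ, hG, s, hs, rfl⟩
  have hRG : ∀ x ∈ interior X, ∀ y ∈ interior X, ∃ T u φ, G T u φ ∧ φ 0 = x ∧ φ T = y := by
    intro x hx y hy
    obtain ⟨T, hT, u, φ, h1, h2, h3, h4, h5, h6⟩ := hR x hx y hy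
    exact ⟨T, u, φ, ⟨hT, h1, h2, h3 ▸ hx, h4 ▸ hy, h5, h6⟩, h3, h4⟩
  have hXR : interior X ⊆ R := by
    intro x hx
    obtain ⟨T, u, φ, hG, h0, -⟩ := hRG x hx x hx
    exact ⟨T, u, φ, hG, 0, ⟨le_rfl, hG.1⟩, h0⟩
  have hRX' : R ⊆ X' := by
    rintro z ⟨T, u, φ, hG, s, hs, rfl⟩
    exact interior_subset (hG.2.2.2.2.2.2 s hs)
  -- two distinct points in the interior of `X`
  obtain ⟨δ, hδ, hfar⟩ : ∃ δ > 0, ∀ y ∈ interior X, ∃ y' ∈ interior X, δ ≤ ‖y' - y‖ := by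
    obtain ⟨p, hp⟩ := hXne
    have hq : ∃ q ∈ interior X, q ≠ p := by
      by_contra hcon
      push Not at hcon
      have h1 : interior X = {p} := Set.Subset.antisymm (fun x hx => hcon x hx)
        (Set.singleton_subset_iff.2 hp)
      have h2 : X = {p} := by
        rw [← hXcl.closure_eq, ← hXcv.closure_interior_eq_closure_of_nonempty_interior ⟨p, hp⟩,
          h1, closure_singleton]
      obtain ⟨w, hw, hwX⟩ := Set.exists_of_ssubset hXX'
      have hwp : w ≠ p := fun h => hwX (h ▸ interior_subset hp)
      have : Nontrivial (Fin n → ℝ) := ⟨w, p, hwp⟩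
      have h3 : IsOpen ({p} : Set (Fin n → ℝ)) := h1 ▸ isOpen_interior
      have := Module.punctured_nhds_neBot ℝ (Fin n → ℝ) p
      exact not_isOpen_singleton p h3
    obtain ⟨q, hq, hqp⟩ := hq
    refine ⟨‖q - p‖ / 2, by have := norm_pos_iff.2 (sub_ne_zero.2 hqp); positivity, ?_⟩
    intro y hy
    by_contra hcon
    push Not at hcon
    have h1 := hcon p hp
    have h2 := hcon q hq
    have h3 : ‖q - p‖ ≤ ‖q - y‖ + ‖p - y‖ := by
      rw [← sub_sub_sub_cancel_right q p y]; exact norm_sub_le _ _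
    linarith
  have hτ : 0 < δ / K := by positivity
  have hlong : ∀ T u φ, G T u φ → δ ≤ ‖φ T - φ 0‖ → δ / K ≤ T := by
    intro T u φ hG h
    have := (hGs T u φ hG 0 T le_rfl hG.1 le_rfl).1
    rw [div_le_iff₀ hK0]
    linarith
  set X₁ := closure (convexHull ℝ R) with hX₁
  have hX₁X' : X₁ ⊆ X' := closure_minimal (convexHull_min hRX' hX'cv) hX'c.isClosed
  have hX₁c : IsCompact X₁ := hX'c.of_isClosed_subset isClosed_closure hX₁X'
  have hX₁v : Convex ℝ X₁ := (convex_convexHull ℝ R).closure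
  have hRX₁ : R ⊆ X₁ := (subset_convexHull ℝ R).trans subset_closure
  have hXX₁ : X ⊆ X₁ := by
    rw [← hXcl.closure_eq, ← hXcv.closure_interior_eq_closure_of_nonempty_interior hXne]
    exact closure_minimal (hXR.trans hRX₁) isClosed_closure
  have hne₁ : (interior X₁).Nonempty := hXne.mono (interior_mono hXX₁)
  have hO : (interior X₁ ∩ equilSet A B a).Nonempty := by
    by_contra hcon
    obtain ⟨o, -, uo, ho⟩ := hO2
    obtain ⟨q, hq0, hq⟩ := exists_functional A' B' a X₁ hX₁v hne₁ o uo ho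
      (fun x hx u hu => hcon ⟨x, hx, u, hu⟩)
    apply hq0
    apply functional_zero_of_const isOpen_interior hXne
    intro x hx y hy
    obtain ⟨T, u, φ, hG, rfl, rfl⟩ := hRG x hx y hy
    have hint := sol_integrable (A := A') (B := B') (a := a) hG.1 hG.2.1 hG.2.2.1 (hGK T u φ hG)
    have e : φ T = φ 0 + ∫ s in (0:ℝ)..T, (A' (φ s) + B' (u s) + a) :=
      hG.2.2.1 T ⟨hG.1, le_rfl⟩
    have e2 : q (φ T) - q (φ 0) = ∫ s in (0:ℝ)..T, q (A' (φ s) + B' (u s) + a) := by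
      rw [ContinuousLinearMap.intervalIntegral_comp_comm q hint, e, map_add]
      ring
    rw [e2, ← neg_nonneg, ← intervalIntegral.integral_neg]
    apply intervalIntegral.integral_nonneg hG.1
    intro s hs
    rw [neg_nonneg]
    exact hq _ (hRX₁ (hGR T u φ hG s hs)) _
  refine ⟨X₁, hX₁c, hX₁v, hne₁, ⟨hXX₁, fun hsub => ?_⟩, hX₁X', hO, ?_, ?_⟩
  · have : X = X₁ := Set.Subset.antisymm hXX₁ hsub
    rw [← this, hO1] at hO
    exact Set.not_nonempty_empty hO
  · intro x hx
    refine viab_tangent A' B' a R hX₁c M (‖A'‖ * K) (δ / K) hτ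
      (steps_of_paths (D := interior X) hK0.le ?_ ?_) x (isClosed_closure.frontier_subset hx)
    · rintro z ⟨T, u, φ, hG, s, hs, rfl⟩
      refine ⟨T - s, by linarith [hs.2], φ T, hG.2.2.2.2.1, hfw T u φ hG s T hs.1 hs.2 le_rfl, ?_⟩
      intro r hr
      refine ⟨φ (s + r), hGR T u φ hG _ ⟨by linarith [hs.1, hr.1], by linarith [hr.2]⟩, ?_⟩
      have := hfw T u φ hG s (s + r) hs.1 (by linarith [hr.1]) (by linarith [hr.2])
      simpa using this
    · intro y hy s hs
      obtain ⟨y', hy', hd⟩ := hfar y hy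
      obtain ⟨T, u, φ, hG, rfl, rfl⟩ := hRG y hy y' hy'
      have hT := hlong T u φ hG hd
      refine ⟨φ s, hGR T u φ hG s ⟨hs.1, hs.2.trans hT⟩, ?_⟩
      simpa using hfw T u φ hG 0 s le_rfl hs.1 (hs.2.trans hT)
  · intro x hx
    have := viab_tangent (-A') (-B') (-a) R hX₁c M (‖-A'‖ * K) (δ / K) hτ
      (steps_of_paths (D := interior X) hK0.le ?_ ?_) x (isClosed_closure.frontier_subset hx)
    · obtain ⟨u, hu⟩ := this
      refine ⟨u, ?_⟩
      have e : -(A.mulVec x) - B.mulVec u - a = (-A') x + (-B') u + -a := by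
        show -(A' x) - B' u - a = _
        simp only [_root_.neg_apply]
        abel
      rw [e]
      exact hu
    · rintro z ⟨T, u, φ, hG, s, hs, rfl⟩
      refine ⟨s, hs.1, φ 0, hG.2.2.2.1, by simpa using hbw T u φ hG 0 s le_rfl hs.1 hs.2, ?_⟩
      intro r hr
      refine ⟨φ (s - r), hGR T u φ hG _ ⟨by linarith [hr.2], by linarith [hr.1, hs.2]⟩, ?_⟩
      have := hbw T u φ hG (s - r) s (by linarith [hr.2]) (by linarith [hr.1]) hs.2
      simpa using this
    · intro y hy s hs
      obtain ⟨y', hy', hd⟩ := hfar y hy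
      obtain ⟨T, u, φ, hG, rfl, rfl⟩ := hRG y' hy' y hy
      have hT := hlong T u φ hG (by rwa [norm_sub_rev])
      refine ⟨φ (T - s), hGR T u φ hG (T - s) ⟨by linarith [hs.2], by linarith [hs.1]⟩, ?_⟩
      have := hbw T u φ hG (T - s) T (by linarith [hs.2]) (by linarith [hs.1]) le_rfl
      simpa using this
end
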